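/- arXiv:0909.0717 — 2 statements merged into one kernel-verified Lean document; each statement's English description precedes it below -/
import Mathlib

section
/- There is an absolute constant C > 0 with the following property. For every finite set P of n points in ℝ² with n ≥ 2 even, there exists a coloring χ: P → {−1, +1} with exactly n/2 points of each color, such that for every closed halfplane h in ℝ², |∑_{p ∈ P ∩ h} χ(p)| ≤ C·|P ∩ h|^{1/4}·log n. -/
open Finset

namespace HalfplaneDiscrepancy

/-- The affine function `x ↦ g₁ x₁ + g₂ x₂ + g₃`. -/
def aff (g : ℝ × ℝ × ℝ) (x : ℝ × ℝ) : ℝ := g.1 * x.1 + g.2.1 * x.2 + g.2.2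

/-- The determinant of the linear parts; it vanishes iff the zero lines are parallel. -/
def crossDet (g h : ℝ × ℝ × ℝ) : ℝ := g.1 * h.2.1 - h.1 * g.2.1

/-- The common zero of two affine functions with nonparallel zero lines. -/
noncomputable def meet (g h : ℝ × ℝ × ℝ) : ℝ × ℝ :=
  ((g.2.1 * h.2.2 - h.2.1 * g.2.2) / crossDet g h, (g.2.2 * h.1 - h.2.2 * g.1) / crossDet g h)

theorem crossDet_swap (g h : ℝ × ℝ × ℝ) : crossDet h g = -crossDet g h := by
  unfold crossDet; ring

theorem meet_comm (g h : ℝ × ℝ × ℝ) : meet g h = meet h g := by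
  unfold meet
  rw [crossDet_swap g h, div_neg, div_neg, ← neg_div, ← neg_div]
  congr 2 <;> ring

theorem aff_meet_left {g h : ℝ × ℝ × ℝ} (hd : crossDet g h ≠ 0) : aff g (meet g h) = 0 := by
  unfold aff meet
  field_simp
  unfold crossDet
  ring

theorem aff_meet_right {g h : ℝ × ℝ × ℝ} (hd : crossDet g h ≠ 0) : aff h (meet g h) = 0 := by
  rw [meet_comm]
  exact aff_meet_left (by rw [crossDet_swap]; exact neg_ne_zero.2 hd)

/-- For points `x`, `y` on the zero line of `g`, the value of `h` changes from `x` to `y` in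
proportion to the displacement along the line. -/
theorem normSq_mul_aff_sub {g h : ℝ × ℝ × ℝ} {x y : ℝ × ℝ} (hx : aff g x = 0) (hy : aff g y = 0) :
    (g.1 ^ 2 + g.2.1 ^ 2) * (aff h y - aff h x) =
      crossDet g h * ((g.1 * y.2 - g.2.1 * y.1) - (g.1 * x.2 - g.2.1 * x.1)) := by
  unfold aff crossDet at *
  linear_combination (g.1 * h.1 + g.2.1 * h.2.1) * (hy - hx)

variable {κ : Type*}

/-- No two of the lines are parallel and no three are concurrent. -/
def GeneralPosition (L : κ → ℝ × ℝ × ℝ) : Prop :=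
  (∀ i j, i ≠ j → crossDet (L i) (L j) ≠ 0) ∧
    ∀ i j l, i ≠ j → l ≠ i → l ≠ j → aff (L l) (meet (L i) (L j)) ≠ 0

theorem mem_pair_of_aff_meet_eq_zero [DecidableEq κ] {L : κ → ℝ × ℝ × ℝ}
    (hL : GeneralPosition L) {i j : κ} (hij : i ≠ j) {l : κ} (hl : aff (L l) (meet (L i) (L j)) = 0) : l ∈ ({i, j} : Finset κ) := by
  rw [mem_insert, mem_singleton]
  by_contra! h
  exact hL.2 i j l hij h.1 h.2 hl

variable [Fintype κ]

/-- The lines strictly separating `x` from `y`. -/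
noncomputable def sep (L : κ → ℝ × ℝ × ℝ) (x y : ℝ × ℝ) : Finset κ :=
  {l | aff (L l) x * aff (L l) y < 0}

theorem mem_sep {L : κ → ℝ × ℝ × ℝ} {x y : ℝ × ℝ} {l : κ} :
    l ∈ sep L x y ↔ aff (L l) x * aff (L l) y < 0 := by simp [sep]

theorem le_card_filter_rank_lt {α : Type*} (S : Finset α) (τ : α → ℝ) {s : ℕ} (hs : s ≤ #S) :
    s ≤ #{l ∈ S | #{j ∈ S | τ j < τ l} < s} := by
  by_contra! hlt
  set A : Finset α := {l ∈ S | #{j ∈ S | τ j < τ l} < s} with hA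
  have hne : {l ∈ S | ¬ #{j ∈ S | τ j < τ l} < s}.Nonempty := by
    rw [← card_pos]
    have := card_filter_add_card_filter_not (s := S) (fun l => #{j ∈ S | τ j < τ l} < s)
    rw [← hA] at this
    omega
  obtain ⟨l, hl, hmin⟩ := exists_min_image _ τ hne
  have hl' := (mem_filter.1 hl)
  apply hl'.2
  refine lt_of_le_of_lt (card_le_card fun j hj => ?_) hlt
  rw [mem_filter] at hj
  by_contra hjA
  have : j ∈ {l ∈ S | ¬ #{j ∈ S | τ j < τ l} < s} := by
    rw [mem_filter]
    refine ⟨hj.1, fun h => hjA ?_⟩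
    rw [hA, mem_filter]; exact ⟨hj.1, h⟩
  exact absurd hj.2 (not_lt.2 (hmin j this))

theorem card_sep_le_rank_of_crossing {L : κ → ℝ × ℝ × ℝ} {p q : ℝ × ℝ} {i l : κ}
    (hi : i ∈ sep L p q) {x : ℝ × ℝ}
    (hx : x = p + (aff (L i) p / (aff (L i) p - aff (L i) q)) • (q - p))
    (hl : l ∈ sep L p x) :
    l ∈ sep L p q ∧ aff (L l) p / (aff (L l) p - aff (L l) q) <
      aff (L i) p / (aff (L i) p - aff (L i) q) := by
  rw [mem_sep] at *
  set τ := aff (L i) p / (aff (L i) p - aff (L i) q) with hτ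
  have hτ0 : 0 < τ ∧ τ < 1 := by
    rcases mul_neg_iff.1 hi with h | h
    · exact ⟨div_pos h.1 (by linarith), (div_lt_one (by linarith)).2 (by linarith)⟩
    · rw [hτ, ← neg_div_neg_eq]
      exact ⟨div_pos (by linarith) (by linarith), (div_lt_one (by linarith)).2 (by linarith)⟩
  have hfx : aff (L l) x = aff (L l) p + τ * (aff (L l) q - aff (L l) p) := by
    rw [hx]; simp [aff]; ring
  rw [hfx] at hl
  rcases mul_neg_iff.1 hl with h | h
  · have hq : aff (L l) q < 0 := by nlinarith
    exact ⟨mul_neg_of_pos_of_neg h.1 hq, (div_lt_iff₀ (by linarith)).2 (by nlinarith)⟩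
  · have hq : 0 < aff (L l) q := by nlinarith
    refine ⟨mul_neg_of_neg_of_pos h.1 hq, ?_⟩
    rw [← neg_div_neg_eq]
    exact (div_lt_iff₀ (by linarith)).2 (by nlinarith)

theorem aff_crossing {g : ℝ × ℝ × ℝ} {p q : ℝ × ℝ} (h : aff g p * aff g q < 0) :
    aff g (p + (aff g p / (aff g p - aff g q)) • (q - p)) = 0 := by
  have hne : aff g p - aff g q ≠ 0 := by
    intro h0
    rw [← sub_eq_zero.1 h0] at h
    exact absurd h (not_lt.2 (mul_self_nonneg _))
  have : aff g (p + (aff g p / (aff g p - aff g q)) • (q - p)) =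
      aff g p + (aff g p / (aff g p - aff g q)) * (aff g q - aff g p) := by
    simp [aff]; ring
  rw [this]
  field_simp
  ring

/-- From a point `x` on the line of `i`, at least `s` crossings with other lines are reached after
passing fewer than `s` lines. -/
theorem le_card_near_on_line [DecidableEq κ] {L : κ → ℝ × ℝ × ℝ} (hL : GeneralPosition L) {s : ℕ}
    (hs : 2 * s + 1 ≤ Fintype.card κ) (p : ℝ × ℝ) {i : κ} {x : ℝ × ℝ} (hx : aff (L i) x = 0)
    (hpx : #(sep L p x) < s) :
    s ≤ #{j | i ≠ j ∧ #(sep L p (meet (L i) (L j))) ≤ 2 * s} := by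
  set t : κ → ℝ := fun j => - aff (L j) x / crossDet (L i) (L j) with ht
  have hval : ∀ j l, i ≠ j → aff (L l) (meet (L i) (L j)) =
      aff (L l) x + t j * crossDet (L i) (L l) := by
    intro j l hij
    have hd := hL.1 i j hij
    have h1 := aff_meet_left hd
    have h2 := aff_meet_right hd
    have hn : (L i).1 ^ 2 + (L i).2.1 ^ 2 ≠ 0 := by
      intro h0
      have h3 : (L i).1 = 0 := by nlinarith [sq_nonneg (L i).1, sq_nonneg (L i).2.1]
      have h4 : (L i).2.1 = 0 := by nlinarith [sq_nonneg (L i).1, sq_nonneg (L i).2.1]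
      apply hd; simp [crossDet, h3, h4]
    have e1 := normSq_mul_aff_sub (h := L l) hx h1
    have e2 := normSq_mul_aff_sub (h := L j) hx h1
    rw [h2] at e2
    have htd : t j * crossDet (L i) (L j) = - aff (L j) x := by
      simp only [ht]; field_simp
    apply mul_left_cancel₀ hn
    apply mul_left_cancel₀ hd
    linear_combination crossDet (L i) (L j) * e1 - crossDet (L i) (L l) * e2
      - ((L i).1 ^ 2 + (L i).2.1 ^ 2) * crossDet (L i) (L l) * htd
  obtain ⟨σ, hσ, hcard⟩ : ∃ σ : ℝ, (σ = 1 ∨ σ = -1) ∧ s ≤ #{j | i ≠ j ∧ 0 ≤ σ * t j} := by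
    by_contra! hcon
    have h1 := hcon 1 (by norm_num)
    have h2 := hcon (-1) (by norm_num)
    have h3 : (univ : Finset κ).erase i ⊆
        ({j | i ≠ j ∧ 0 ≤ 1 * t j} : Finset κ) ∪ ({j | i ≠ j ∧ 0 ≤ -1 * t j} : Finset κ) := by
      intro j hj
      have hj := (mem_erase.1 hj).1
      rcases le_total 0 (t j) with h | h
      · exact mem_union_left _ (by simpa using ⟨hj.symm, h⟩)
      · exact mem_union_right _ (by simpa using ⟨hj.symm, h⟩)
    have h4 := (card_le_card h3).trans (card_union_le _ _)
    rw [card_erase_of_mem (mem_univ _), card_univ] at h4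
    omega
  refine (le_card_filter_rank_lt _ (fun j => σ * t j) hcard).trans (card_le_card fun j hj => ?_)
  simp only [mem_filter, mem_univ, true_and] at hj ⊢
  obtain ⟨⟨hij, hj0⟩, hrank⟩ := hj
  refine ⟨hij, ?_⟩
  have hsub : sep L p (meet (L i) (L j)) ⊆ sep L p x ∪
      {l ∈ ({j | i ≠ j ∧ 0 ≤ σ * t j} : Finset κ) | σ * t l < σ * t j} := by
    intro l hl
    rw [mem_union]
    by_cases hlx : l ∈ sep L p x
    · exact Or.inl hlx
    right
    rw [mem_sep] at hl hlx
    have hil : i ≠ l := by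
      rintro rfl
      rw [aff_meet_left (hL.1 _ _ hij)] at hl
      simp at hl
    have hd := hL.1 i l hil
    set y := aff (L l) x with hy
    set d := crossDet (L i) (L l) with hdd
    have htl : y = - (t l * d) := by simp only [ht, ← hdd, ← hy]; field_simp
    rw [hval j l hij, ← hy, ← hdd, htl] at hl
    have hprod : 0 ≤ aff (L l) p * y := not_lt.1 hlx
    rw [htl] at hprod
    have hneg : (aff (L l) p * d) * (t j - t l) < 0 := by linarith
    have hnonpos : (aff (L l) p * d) * t l ≤ 0 := by linarith
    simp only [mem_filter, mem_univ, true_and]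
    rcases mul_neg_iff.1 hneg with ⟨h1, h2⟩ | ⟨h1, h2⟩
    · have h3 : t l ≤ 0 := by by_contra! h; exact absurd hnonpos (not_le.2 (mul_pos h1 h))
      rcases hσ with rfl | rfl
      · linarith
      · exact ⟨⟨hil, by linarith⟩, by linarith⟩
    · have h3 : 0 ≤ t l := by
        by_contra! h; exact absurd hnonpos (not_le.2 (mul_pos_of_neg_of_neg h1 h))
      rcases hσ with rfl | rfl
      · exact ⟨⟨hil, by linarith⟩, by linarith⟩
      · linarith
  have := (card_le_card hsub).trans (card_union_le _ _)
  omega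

/-- A point `p` separated from some other point by more than `2 s` lines has at least `s ^ 2`
ordered crossings at distance at most `2 s`. -/
theorem sq_le_card_near [DecidableEq κ] {L : κ → ℝ × ℝ × ℝ} (hL : GeneralPosition L) {s : ℕ}
    {p q : ℝ × ℝ} (hpq : 2 * s + 1 ≤ #(sep L p q)) :
    s * s ≤ #{ij : κ × κ | ij.1 ≠ ij.2 ∧ #(sep L p (meet (L ij.1) (L ij.2))) ≤ 2 * s} := by
  set τ : κ → ℝ := fun l => aff (L l) p / (aff (L l) p - aff (L l) q) with hτ
  have hI := le_card_filter_rank_lt (sep L p q) τ (s := s) (by omega)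
  set I := {l ∈ sep L p q | #{j ∈ sep L p q | τ j < τ l} < s}
  have hcard : 2 * s + 1 ≤ Fintype.card κ := hpq.trans (card_le_univ _)
  have hrow : ∀ i ∈ I, s ≤ #{j | i ≠ j ∧ #(sep L p (meet (L i) (L j))) ≤ 2 * s} := by
    intro i hi
    obtain ⟨hi, hrank⟩ := mem_filter.1 hi
    refine le_card_near_on_line hL hcard p (aff_crossing (mem_sep.1 hi)) ?_
    refine lt_of_le_of_lt (card_le_card fun l hl => ?_) hrank
    exact mem_filter.2 (card_sep_le_rank_of_crossing hi rfl hl)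
  calc s * s ≤ #I * s := Nat.mul_le_mul_right _ hI
    _ ≤ ∑ i ∈ I, #{j | i ≠ j ∧ #(sep L p (meet (L i) (L j))) ≤ 2 * s} := by
        rw [← smul_eq_mul]; exact card_nsmul_le_sum _ _ _ hrow
    _ ≤ ∑ i, #{j | i ≠ j ∧ #(sep L p (meet (L i) (L j))) ≤ 2 * s} :=
        sum_le_sum_of_subset (subset_univ _)
    _ = _ := by
        simp only [card_filter]
        rw [Fintype.sum_prod_type]

theorem card_sep_le_of_near [DecidableEq κ] {L : κ → ℝ × ℝ × ℝ} (hL : GeneralPosition L) {s : ℕ}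
    {p q : ℝ × ℝ} {i j : κ} (hij : i ≠ j) (hp : #(sep L p (meet (L i) (L j))) ≤ 2 * s)
    (hq : #(sep L q (meet (L i) (L j))) ≤ 2 * s) : #(sep L p q) ≤ 4 * s + 2 := by
  have hsub : sep L p q ⊆ sep L p (meet (L i) (L j)) ∪ (sep L q (meet (L i) (L j)) ∪ {i, j}) := by
    intro l hl
    rw [mem_union, mem_union, mem_sep, mem_sep]
    rw [mem_sep] at hl
    rcases lt_trichotomy (aff (L l) (meet (L i) (L j))) 0 with h | h | h
    · rcases mul_neg_iff.1 hl with h' | h'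
      · exact Or.inl (mul_neg_of_pos_of_neg h'.1 h)
      · exact Or.inr (Or.inl (mul_neg_of_pos_of_neg h'.2 h))
    · exact Or.inr (Or.inr (mem_pair_of_aff_meet_eq_zero hL hij h))
    · rcases mul_neg_iff.1 hl with h' | h'
      · exact Or.inr (Or.inl (mul_neg_of_neg_of_pos h'.2 h))
      · exact Or.inl (mul_neg_of_neg_of_pos h'.1 h)
  have h1 := (card_le_card hsub).trans (card_union_le _ _)
  have h2 := card_union_le (sep L q (meet (L i) (L j))) {i, j}
  have h3 := card_le_two (a := i) (b := j)
  omega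

/-- Along a fixed line, the crossings of small weighted closed depth have small total weight. -/
theorem sum_shallow_on_line_le [DecidableEq κ] {L : κ → ℝ × ℝ × ℝ} (hL : GeneralPosition L)
    {ν : κ → ℝ} (hν : ∀ l, 0 ≤ ν l) {X : ℝ} (hX : 0 ≤ X) (i : κ) (J : Finset κ)
    (hJ : ∀ j ∈ J, i ≠ j ∧ ∑ l with 0 ≤ aff (L l) (meet (L i) (L j)), ν l ≤ X) :
    ∑ j ∈ J, ν j ≤ 2 * X := by
  set pos : κ → ℝ := fun j =>
    (L i).1 * (meet (L i) (L j)).2 - (L i).2.1 * (meet (L i) (L j)).1 with hpos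
  have key : ∀ j ∈ J, ∀ j' ∈ J, 0 ≤ crossDet (L i) (L j') * (pos j - pos j') →
      0 ≤ aff (L j') (meet (L i) (L j)) := by
    intro j hj j' hj' h
    have hd := hL.1 i j (hJ j hj).1
    have hd' := hL.1 i j' (hJ j' hj').1
    have e := normSq_mul_aff_sub (h := L j') (aff_meet_left hd') (aff_meet_left hd)
    rw [aff_meet_right hd', sub_zero] at e
    have hn : 0 < (L i).1 ^ 2 + (L i).2.1 ^ 2 := by
      rcases eq_or_ne (L i).1 0 with h3 | h3
      · rcases eq_or_ne (L i).2.1 0 with h4 | h4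
        · exact absurd (by simp [crossDet, h3, h4]) hd
        · positivity
      · positivity
    refine nonneg_of_mul_nonneg_right ?_ hn
    rw [e]; exact h
  have half : ∀ J' ⊆ J, (∃ j ∈ J', ∀ j' ∈ J', 0 ≤ crossDet (L i) (L j') * (pos j - pos j')) →
      ∑ j ∈ J', ν j ≤ X := by
    rintro J' hJ' ⟨j, hj, hmax⟩
    refine le_trans (sum_le_sum_of_subset_of_nonneg ?_ fun l _ _ => hν l) (hJ j (hJ' hj)).2
    intro j' hj'
    exact mem_filter.2 ⟨mem_univ _, key j (hJ' hj) j' (hJ' hj') (hmax j' hj')⟩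
  have hposi : ∑ j ∈ J with 0 ≤ crossDet (L i) (L j), ν j ≤ X := by
    rcases (J.filter fun j => 0 ≤ crossDet (L i) (L j)).eq_empty_or_nonempty with h | h
    · rw [h]; simpa
    · obtain ⟨j, hj, hmax⟩ := exists_max_image _ pos h
      exact half _ (filter_subset _ _) ⟨j, hj, fun j' hj' =>
        mul_nonneg (mem_filter.1 hj').2 (sub_nonneg.2 (hmax j' hj'))⟩
  have hnegi : ∑ j ∈ J with ¬ 0 ≤ crossDet (L i) (L j), ν j ≤ X := by
    rcases (J.filter fun j => ¬ 0 ≤ crossDet (L i) (L j)).eq_empty_or_nonempty with h | h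
    · rw [h]; simpa
    · obtain ⟨j, hj, hmin⟩ := exists_min_image _ pos h
      exact half _ (filter_subset _ _) ⟨j, hj, fun j' hj' =>
        mul_nonneg_of_nonpos_of_nonpos (not_le.1 (mem_filter.1 hj').2).le
          (sub_nonpos.2 (hmin j' hj'))⟩
  rw [← sum_filter_add_sum_filter_not J (fun j => 0 ≤ crossDet (L i) (L j))]
  linarith

/-- The relative short edge lemma for unit weights and lines in general position. -/
theorem exists_pair_card_sep_le [DecidableEq κ] {L : κ → ℝ × ℝ × ℝ} (hL : GeneralPosition L)
    (Q : Finset (ℝ × ℝ)) (hQ : 2 ≤ #Q) (hne : ∀ l, ∀ p ∈ Q, aff (L l) p ≠ 0) {k : κ → ℕ}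
    (hk : ∀ l, k l = #{p ∈ Q | 0 < aff (L l) p}) (hk1 : ∀ l, 1 ≤ k l)
    (hδ : (#Q : ℝ) ≤ ∑ l, √(k l : ℝ)) :
    ∃ p ∈ Q, ∃ q ∈ Q, p ≠ q ∧ (#(sep L p q) : ℝ) ≤ 46 / #Q * ∑ l, √(k l : ℝ) := by
  classical
  by_contra! hcon
  have hm : (0 : ℝ) < #Q := by exact_mod_cast (by omega : 0 < #Q)
  obtain ⟨m, hm'⟩ : ∃ m : ℝ, m = #Q := ⟨_, rfl⟩
  rw [← hm'] at hm hδ hcon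
  obtain ⟨δ, hδ'⟩ : ∃ δ : ℝ, δ = (∑ l, √(k l : ℝ)) / m := ⟨_, rfl⟩
  have hsum : ∑ l, √(k l : ℝ) = m * δ := by rw [hδ']; field_simp
  have hδ1 : 1 ≤ δ := by rw [hδ', le_div_iff₀ hm]; linarith
  have hsep : ∀ p ∈ Q, ∀ q ∈ Q, p ≠ q → 46 * δ < #(sep L p q) := by
    intro p hp q hq hpq
    refine lt_of_eq_of_lt ?_ (hcon p hp q hq hpq)
    rw [hδ']; ring
  obtain ⟨s, hs1, hs2⟩ : ∃ s : ℕ, 10 * δ ≤ s ∧ (s : ℝ) < 10 * δ + 1 :=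
    ⟨⌈10 * δ⌉₊, Nat.le_ceil _, Nat.ceil_lt_add_one (by linarith)⟩
  have hsepN : ∀ p ∈ Q, ∀ q ∈ Q, p ≠ q → 4 * s + 2 < #(sep L p q) := by
    intro p hp q hq hpq
    have : ((4 * s + 2 : ℕ) : ℝ) < #(sep L p q) := by
      push_cast; linarith [hsep p hp q hq hpq]
    exact_mod_cast this
  set ν : κ → ℝ := fun l => 1 / √(k l : ℝ) with hν
  have hk1' : ∀ l, (1 : ℝ) ≤ √(k l : ℝ) := fun l =>
    Real.one_le_sqrt.2 (by exact_mod_cast hk1 l)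
  have hν0 : ∀ l, 0 ≤ ν l := fun l => by simp only [hν]; positivity
  have hν1 : ∀ l, ν l ≤ 1 := fun l => by
    simp only [hν]; rw [div_le_one (by linarith [hk1' l])]; exact hk1' l
  have hνk : ∀ l, ν l * k l = √(k l : ℝ) := fun l => by
    have := hk1' l
    have h2 := Real.mul_self_sqrt (Nat.cast_nonneg (α := ℝ) (k l))
    simp only [hν]; field_simp; nlinarith
  have hνs : ∀ l, ν l * √(k l : ℝ) = 1 := fun l => by
    have := hk1' l
    simp only [hν]; field_simp
  set depth : ℝ × ℝ → ℝ := fun p => ∑ l with 0 < aff (L l) p, ν l with hdepth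
  have hdsum : ∑ p ∈ Q, depth p = m * δ := by
    rw [← hsum]
    simp only [hdepth, sum_filter]
    rw [sum_comm]
    refine sum_congr rfl fun l _ => ?_
    rw [← sum_filter, sum_const, nsmul_eq_mul, ← hk l, mul_comm, hνk l]
  set Q' : Finset (ℝ × ℝ) := {p ∈ Q | depth p ≤ 2 * δ} with hQ'
  have hQ'card : m ≤ 2 * #Q' := by
    have h1 : (#{p ∈ Q | ¬ depth p ≤ 2 * δ} : ℝ) * (2 * δ) ≤ m * δ := by
      rw [← hdsum, ← nsmul_eq_mul]
      refine (card_nsmul_le_sum _ depth _ fun p hp => (not_le.1 (mem_filter.1 hp).2).le).trans ?_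
      exact sum_le_sum_of_subset_of_nonneg (filter_subset _ _)
        fun p _ _ => sum_nonneg fun l _ => hν0 l
    have h2 := card_filter_add_card_filter_not (s := Q) (fun p => depth p ≤ 2 * δ)
    have h3 : (#Q' : ℝ) + #{p ∈ Q | ¬ depth p ≤ 2 * δ} = m := by
      rw [hm', ← h2, Nat.cast_add]
    have h4 : (#{p ∈ Q | ¬ depth p ≤ 2 * δ} : ℝ) * 2 ≤ m := by
      refine le_of_mul_le_mul_right ?_ (by linarith : 0 < δ)
      linarith
    linarith
  set B : ℝ × ℝ → Finset (κ × κ) := fun p =>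
    {ij | ij.1 ≠ ij.2 ∧ #(sep L p (meet (L ij.1) (L ij.2))) ≤ 2 * s} with hB
  have hBcard : ∀ p ∈ Q', s * s ≤ #(B p) := by
    intro p hp
    have hp := (mem_filter.1 hp).1
    obtain ⟨q, hq, hqp⟩ := exists_mem_ne (by omega : 1 < #Q) p
    exact sq_le_card_near hL (q := q) (by have := hsepN p hp q hq hqp.symm; omega)
  have hdisj : (Q' : Set (ℝ × ℝ)).PairwiseDisjoint B := by
    intro p hp q hq hpq
    rw [Function.onFun, Finset.disjoint_left]
    intro ij h1 h2
    simp only [hB, mem_filter, mem_univ, true_and] at h1 h2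
    have h3 := card_sep_le_of_near hL h1.1 h1.2 h2.2
    have h4 := hsepN p (mem_filter.1 hp).1 q (mem_filter.1 hq).1 hpq
    omega
  set G := Q'.biUnion B with hG
  have hGlow : #Q' * (s * s) ≤ #G := by
    rw [hG, card_biUnion hdisj, ← smul_eq_mul]
    exact card_nsmul_le_sum _ _ _ hBcard
  set X : ℝ := 2 * δ + 2 * s + 2 with hX
  have hX0 : 0 ≤ X := by positivity
  have hGmem : ∀ i j, (i, j) ∈ G →
      i ≠ j ∧ ∑ l with 0 ≤ aff (L l) (meet (L i) (L j)), ν l ≤ X := by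
    intro i j hij
    obtain ⟨p, hp, hij⟩ := mem_biUnion.1 hij
    simp only [hB, mem_filter, mem_univ, true_and] at hij
    refine ⟨hij.1, ?_⟩
    have hpQ := (mem_filter.1 hp)
    have hsub : ({l | 0 ≤ aff (L l) (meet (L i) (L j))} : Finset κ) ⊆
        ({l | 0 < aff (L l) p} : Finset κ) ∪ (sep L p (meet (L i) (L j)) ∪ {i, j}) := by
      intro l hl
      have hl := (mem_filter.1 hl).2
      rw [mem_union, mem_union, mem_sep]
      rcases (hne l p hpQ.1).lt_or_gt with h | h
      · rcases hl.eq_or_lt with h' | h'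
        · exact Or.inr (Or.inr (mem_pair_of_aff_meet_eq_zero hL hij.1 h'.symm))
        · exact Or.inr (Or.inl (mul_neg_of_neg_of_pos h h'))
      · exact Or.inl (by simpa using h)
    have hν_card : ∀ S : Finset κ, ∑ l ∈ S, ν l ≤ #S := fun S => by
      simpa using sum_le_card_nsmul S ν 1 fun l _ => hν1 l
    have hun : ∀ S T : Finset κ, ∑ l ∈ S ∪ T, ν l ≤ ∑ l ∈ S, ν l + ∑ l ∈ T, ν l := fun S T => by
      rw [← sum_union_inter]
      exact le_add_of_nonneg_right (sum_nonneg fun l _ => hν0 l)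
    have h1 := sum_le_sum_of_subset_of_nonneg hsub fun l _ _ => hν0 l
    have h2 := hun ({l | 0 < aff (L l) p} : Finset κ) (sep L p (meet (L i) (L j)) ∪ {i, j})
    have h3 := hun (sep L p (meet (L i) (L j))) {i, j}
    have h4 := hν_card (sep L p (meet (L i) (L j)))
    have h5 := hν_card {i, j}
    have h6 : (#({i, j} : Finset κ) : ℝ) ≤ 2 := by exact_mod_cast card_le_two
    have h7 : (#(sep L p (meet (L i) (L j))) : ℝ) ≤ 2 * s := by exact_mod_cast hij.2
    have h8 : ∑ l with 0 < aff (L l) p, ν l ≤ 2 * δ := hpQ.2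
    linarith
  have hGsymm : ∀ i j, (i, j) ∈ G → (j, i) ∈ G := by
    intro i j hij
    obtain ⟨p, hp, hij⟩ := mem_biUnion.1 hij
    refine mem_biUnion.2 ⟨p, hp, ?_⟩
    simp only [hB, mem_filter, mem_univ, true_and] at hij ⊢
    rw [meet_comm]
    exact ⟨hij.1.symm, hij.2⟩
  have hrow : ∑ ij ∈ G, ν ij.1 * ν ij.2 * k ij.1 ≤ 2 * X * (m * δ) := by
    have e : ∑ ij ∈ G, ν ij.1 * ν ij.2 * k ij.1 =
        ∑ i, √(k i : ℝ) * ∑ j with (i, j) ∈ G, ν j := by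
      rw [sum_finset_product G univ (fun i => {j | (i, j) ∈ G}) (by simp)]
      refine sum_congr rfl fun i _ => ?_
      rw [mul_sum]
      refine sum_congr rfl fun j _ => ?_
      rw [← hνk i]; ring
    rw [e, ← hsum, mul_sum]
    refine sum_le_sum fun i _ => ?_
    rw [mul_comm]
    refine mul_le_mul_of_nonneg_right ?_ (Real.sqrt_nonneg _)
    exact sum_shallow_on_line_le hL hν0 hX0 i _ fun j hj => hGmem i j (mem_filter.1 hj).2
  have hcol : ∑ ij ∈ G, ν ij.1 * ν ij.2 * k ij.2 = ∑ ij ∈ G, ν ij.1 * ν ij.2 * k ij.1 := by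
    refine sum_nbij' Prod.swap Prod.swap (fun ij h => hGsymm _ _ h) (fun ij h => hGsymm _ _ h)
      (fun _ _ => rfl) (fun _ _ => rfl) fun ij _ => ?_
    simp only [Prod.fst_swap, Prod.snd_swap]; ring
  have hGup : (#G : ℝ) ≤ 2 * X * (m * δ) := by
    have h1 : ∀ ij ∈ G, (1 : ℝ) ≤
        (ν ij.1 * ν ij.2 * k ij.1 + ν ij.1 * ν ij.2 * k ij.2) / 2 := by
      rintro ⟨i, j⟩ -
      have e1 := Real.mul_self_sqrt (Nat.cast_nonneg (α := ℝ) (k i))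
      have e2 := Real.mul_self_sqrt (Nat.cast_nonneg (α := ℝ) (k j))
      have e3 : (1 : ℝ) = ν i * ν j * (√(k i : ℝ) * √(k j : ℝ)) := by
        linear_combination (-1 : ℝ) * hνs i - ν i * √(k i : ℝ) * hνs j
      have e4 := mul_nonneg (mul_nonneg (hν0 i) (hν0 j)) (sq_nonneg (√(k i : ℝ) - √(k j : ℝ)))
      calc (1 : ℝ) = ν i * ν j * (√(k i : ℝ) * √(k j : ℝ)) := e3
        _ ≤ (ν i * ν j * (√(k i : ℝ) * √(k i : ℝ)) + ν i * ν j * (√(k j : ℝ) * √(k j : ℝ))) / 2 := by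
          linarith
        _ = _ := by rw [e1, e2]
    have h2 := sum_le_sum h1
    rw [← sum_div, sum_add_distrib, hcol, sum_const, nsmul_eq_mul, mul_one] at h2
    linarith
  have hlow : m * (s * s) ≤ 2 * #G := by
    have h1 : (#Q' : ℝ) * (s * s) ≤ #G := by exact_mod_cast hGlow
    nlinarith [mul_le_mul_of_nonneg_right hQ'card (by positivity : (0 : ℝ) ≤ s * s)]
  have hfin : (s : ℝ) * s ≤ 4 * X * δ := by
    refine le_of_mul_le_mul_left ?_ hm
    linarith
  rw [hX] at hfin
  nlinarith [mul_le_mul hs1 hs1 (by positivity) (by positivity),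
    mul_le_mul_of_nonneg_right hs1 (by linarith : 0 ≤ (s : ℝ) - 8 * δ)]

theorem eventually_cubic_ne_zero (c₀ c₁ : ℝ) {c₂ c₃ : ℝ} (h : c₃ ≠ 0 ∨ c₂ ≠ 0) :
    ∀ᶠ ε in nhdsWithin (0 : ℝ) (Set.Ioi 0), c₀ + c₁ * ε + c₂ * ε ^ 2 + c₃ * ε ^ 3 ≠ 0 := by
  have hp : (⟨c₃, c₂, c₁, c₀⟩ : Cubic ℝ).toPoly ≠ 0 :=
    h.elim (fun h => Cubic.ne_zero_of_a_ne_zero h) fun h => Cubic.ne_zero_of_b_ne_zero h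
  have hfin := (Polynomial.finite_setOfPred_isRoot hp).subset
    (Set.sdiff_subset (t := {(0 : ℝ)}))
  have hmem := hfin.isClosed.isOpen_compl.mem_nhds (x := (0 : ℝ)) (by simp)
  filter_upwards [nhdsWithin_le_nhds hmem, self_mem_nhdsWithin] with ε h1 h2 h3
  refine h1 ⟨?_, (Set.mem_Ioi.1 h2).ne'⟩
  simp only [Set.mem_ofPred_eq, Polynomial.IsRoot, Cubic.toPoly, Polynomial.eval_add,
    Polynomial.eval_mul, Polynomial.eval_C, Polynomial.eval_pow, Polynomial.eval_X]
  linarith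

/-- The determinant of three affine functions; it vanishes if their zero lines are concurrent. -/
def tripleDet (g h k : ℝ × ℝ × ℝ) : ℝ :=
  k.1 * (g.2.1 * h.2.2 - h.2.1 * g.2.2) + k.2.1 * (g.2.2 * h.1 - h.2.2 * g.1) +
    k.2.2 * crossDet g h

theorem aff_meet_eq_div {g h k : ℝ × ℝ × ℝ} (hd : crossDet g h ≠ 0) :
    aff k (meet g h) = tripleDet g h k / crossDet g h := by
  unfold aff meet tripleDet
  field_simp

/-- Finitely many lines can be moved into general position without passing over given points. -/
theorem exists_generalPosition {κ : Type*} [Fintype κ] (L : κ → ℝ × ℝ × ℝ) (Q : Finset (ℝ × ℝ))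
    (hne : ∀ l, ∀ p ∈ Q, aff (L l) p ≠ 0) :
    ∃ L' : κ → ℝ × ℝ × ℝ, GeneralPosition L' ∧ ∀ l, ∀ p ∈ Q, 0 < aff (L l) p * aff (L' l) p := by
  obtain ⟨x, hx⟩ : ∃ x : κ → ℝ, Function.Injective x :=
    ⟨fun l => (Fintype.equivFin κ l : ℕ), fun a b h =>
      (Fintype.equivFin κ).injective (Fin.ext (Nat.cast_injective h))⟩
  set v : κ → ℝ × ℝ × ℝ := fun l => (1, x l, x l ^ 2) with hv
  have hxne : ∀ i j, i ≠ j → x j - x i ≠ 0 := fun i j h =>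
    sub_ne_zero.2 fun h' => h (hx h').symm
  have hcross : ∀ᶠ ε in nhdsWithin (0 : ℝ) (Set.Ioi 0),
      ∀ i j, i ≠ j → crossDet (L i + ε • v i) (L j + ε • v j) ≠ 0 := by
    simp only [Filter.eventually_all]
    intro i j hij
    filter_upwards [eventually_cubic_ne_zero (crossDet (L i) (L j))
      (crossDet (v i) (L j) + crossDet (L i) (v j)) (c₂ := x j - x i) (c₃ := 0)
      (Or.inr (hxne i j hij))] with ε hε
    convert hε using 1
    simp [crossDet, hv]; ring
  have htriple : ∀ᶠ ε in nhdsWithin (0 : ℝ) (Set.Ioi 0), ∀ i j l, i ≠ j → l ≠ i → l ≠ j →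
      tripleDet (L i + ε • v i) (L j + ε • v j) (L l + ε • v l) ≠ 0 := by
    simp only [Filter.eventually_all]
    intro i j l hij hli hlj
    filter_upwards [eventually_cubic_ne_zero (tripleDet (L i) (L j) (L l))
      (tripleDet (v i) (L j) (L l) + tripleDet (L i) (v j) (L l) + tripleDet (L i) (L j) (v l))
      (c₂ := tripleDet (v i) (v j) (L l) + tripleDet (v i) (L j) (v l) +
        tripleDet (L i) (v j) (v l))
      (c₃ := (x j - x i) * ((x l - x i) * (x l - x j)))
      (Or.inl (mul_ne_zero (hxne i j hij) (mul_ne_zero (hxne i l hli.symm) (hxne j l hlj.symm))))]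
      with ε hε
    convert hε using 1
    simp [crossDet, tripleDet, hv]; ring
  have hsign : ∀ᶠ ε in nhdsWithin (0 : ℝ) (Set.Ioi 0),
      ∀ l, ∀ p ∈ Q, 0 < aff (L l) p * aff (L l + ε • v l) p := by
    simp only [Filter.eventually_all, Filter.eventually_all_finset]
    intro l p hp
    have hc : Continuous fun ε : ℝ => aff (L l) p * aff (L l + ε • v l) p := by
      simp only [aff, Prod.fst_add, Prod.snd_add, Prod.smul_fst, Prod.smul_snd, smul_eq_mul]
      fun_prop
    refine nhdsWithin_le_nhds (hc.continuousAt.eventually (lt_mem_nhds ?_))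
    simpa using mul_self_pos.2 (hne l p hp)
  obtain ⟨ε, h1, h2, h3⟩ := (hcross.and (htriple.and hsign)).exists
  refine ⟨fun l => L l + ε • v l, ⟨h1, fun i j l hij hli hlj => ?_⟩, h3⟩
  rw [aff_meet_eq_div (h1 i j hij)]
  exact div_ne_zero (h2 i j l hij hli hlj) (h1 i j hij)

/-- The relative short edge lemma: some pair of points of `Q` is separated by halfplanes of small
total weight, when a halfplane with `k` points of `Q` is discounted by `√k`. -/
theorem exists_pair_weight_sep_le {ι : Type*} [Fintype ι] {L : ι → ℝ × ℝ × ℝ}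
    (Q : Finset (ℝ × ℝ)) (hQ : 2 ≤ #Q) (hne : ∀ l, ∀ p ∈ Q, aff (L l) p ≠ 0) {w : ι → ℝ}
    (hw : ∀ l, 0 < w l) :
    ∃ p ∈ Q, ∃ q ∈ Q, p ≠ q ∧
      ∑ l ∈ sep L p q, w l / √(#{p ∈ Q | 0 < aff (L l) p} : ℝ) ≤ 92 / #Q * ∑ l, w l := by
  classical
  obtain ⟨k, hk⟩ : ∃ k : ι → ℕ, ∀ l, k l = #{p ∈ Q | 0 < aff (L l) p} := ⟨_, fun _ => rfl⟩
  simp only [← hk]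
  have hm : (0 : ℝ) < #Q := by exact_mod_cast (by omega : 0 < #Q)
  obtain ⟨μ, hμ⟩ : ∃ μ : ι → ℝ, ∀ l, μ l = w l / √(k l : ℝ) := ⟨_, fun _ => rfl⟩
  simp only [← hμ]
  have hμ0 : ∀ l, 0 ≤ μ l := fun l => by rw [hμ]; exact div_nonneg (hw l).le (Real.sqrt_nonneg _)
  have hμk : ∀ l, μ l * √(k l : ℝ) ≤ w l := fun l => by
    rw [hμ, div_mul_eq_mul_div]
    exact div_le_of_le_mul₀ (Real.sqrt_nonneg _) (hw l).le le_rfl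
  by_cases hall : ∀ l, μ l = 0
  · obtain ⟨p, hp, q, hq, hpq⟩ := one_lt_card.1 (by omega : 1 < #Q)
    refine ⟨p, hp, q, hq, hpq, ?_⟩
    simp only [hall, sum_const_zero]
    exact mul_nonneg (by positivity) (sum_nonneg fun l _ => (hw l).le)
  push Not at hall
  obtain ⟨l₀, hl₀⟩ := hall
  have hpos : ∀ l, μ l ≠ 0 → 0 < μ l := fun l h => lt_of_le_of_ne (hμ0 l) h.symm
  obtain ⟨N, hN0, hN⟩ : ∃ N : ℝ, 0 < N ∧ ∀ l, μ l ≠ 0 → #Q ≤ N * μ l := by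
    have hN : ∀ l, μ l ≠ 0 → #Q ≤ (∑ l, #Q / μ l) * μ l := fun l hl => by
      rw [← div_le_iff₀ (hpos l hl)]
      exact single_le_sum (f := fun l => (#Q : ℝ) / μ l)
        (fun l _ => div_nonneg hm.le (hμ0 l)) (mem_univ l)
    exact ⟨_, pos_of_mul_pos_left (hm.trans_le (hN l₀ hl₀)) (hμ0 l₀), hN⟩
  have hQ1 : (1 : ℝ) ≤ #Q := by exact_mod_cast (by omega : 1 ≤ #Q)
  obtain ⟨n, hn⟩ : ∃ n : ι → ℕ, ∀ l, n l = ⌈N * μ l⌉₊ := ⟨_, fun _ => rfl⟩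
  have hn1 : ∀ l, N * μ l ≤ n l := fun l => by rw [hn]; exact Nat.le_ceil _
  have hn2 : ∀ l, (n l : ℝ) ≤ 2 * N * μ l := fun l => by
    rcases eq_or_ne (μ l) 0 with h | h
    · simp [hn, h]
    · have h1 := Nat.ceil_lt_add_one (mul_nonneg hN0.le (hμ0 l))
      rw [← hn] at h1
      linarith [hN l h]
  have hk1 : ∀ l, 0 < n l → 1 ≤ k l := fun l h => by
    by_contra! h'
    have : μ l = 0 := by rw [hμ, Nat.lt_one_iff.1 h']; simp
    rw [hn, this] at h
    simp at h
  obtain ⟨L', hL', hsign⟩ := exists_generalPosition (κ := Σ l, Fin (n l)) (fun l => L l.1) Q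
    fun l => hne l.1
  have hne' : ∀ l, ∀ p ∈ Q, aff (L' l) p ≠ 0 := fun l p hp h => by
    have := hsign l p hp
    rw [h, mul_zero] at this
    exact lt_irrefl _ this
  have hk' : ∀ l : Σ l, Fin (n l), k l.1 = #{p ∈ Q | 0 < aff (L' l) p} := fun l => by
    rw [hk]
    congr 1
    refine filter_congr fun p hp => ?_
    rcases mul_pos_iff.1 (hsign l p hp) with h | h
    · simp [h.1, h.2]
    · exact iff_of_false (not_lt.2 h.1.le) (not_lt.2 h.2.le)
  have hsum : ∑ l : Σ l, Fin (n l), √(k l.1 : ℝ) = ∑ l, n l * √(k l : ℝ) := by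
    rw [Fintype.sum_sigma]
    simp
  have hsumk : ∑ l, n l * √(k l : ℝ) ≤ 2 * N * ∑ l, w l := by
    rw [mul_sum]
    refine sum_le_sum fun l _ => ?_
    calc n l * √(k l : ℝ) ≤ 2 * N * μ l * √(k l : ℝ) :=
          mul_le_mul_of_nonneg_right (hn2 l) (Real.sqrt_nonneg _)
      _ = 2 * N * (μ l * √(k l : ℝ)) := by ring
      _ ≤ 2 * N * w l := mul_le_mul_of_nonneg_left (hμk l) (by positivity)
  have hδ : (#Q : ℝ) ≤ ∑ l : Σ l, Fin (n l), √(k l.1 : ℝ) := by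
    rw [hsum]
    have h1 : (#Q : ℝ) ≤ n l₀ := (hN l₀ hl₀).trans (hn1 l₀)
    have h2 : (1 : ℝ) ≤ √(k l₀ : ℝ) := Real.one_le_sqrt.2 <| by
      exact_mod_cast hk1 l₀ (by exact_mod_cast hm.trans_le h1)
    refine le_trans ?_ (single_le_sum (f := fun l => n l * √(k l : ℝ)) (fun l _ => by positivity)
      (mem_univ l₀))
    exact h1.trans (le_mul_of_one_le_right (Nat.cast_nonneg _) h2)
  obtain ⟨p, hp, q, hq, hpq, hle⟩ := exists_pair_card_sep_le hL' Q hQ hne'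
    (k := fun l => k l.1) hk' (fun l => hk1 l.1 (Fin.pos l.2)) hδ
  refine ⟨p, hp, q, hq, hpq, ?_⟩
  have hcard : (#(sep L' p q) : ℝ) = ∑ l ∈ sep L p q, (n l : ℝ) := by
    have : sep L' p q = (sep L p q).sigma fun l => (univ : Finset (Fin (n l))) := by
      ext l
      rw [mem_sigma, mem_sep, mem_sep]
      have h1 := hsign l p hp
      have h2 := hsign l q hq
      rw [and_iff_left (mem_univ _)]
      have h3 := mul_pos h1 h2
      have h4 : 0 < aff (L l.1) p * aff (L l.1) q * (aff (L' l) p * aff (L' l) q) := by linarith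
      rcases mul_pos_iff.1 h4 with h | h
      · exact iff_of_false (not_lt.2 h.2.le) (not_lt.2 h.1.le)
      · exact iff_of_true h.2 h.1
    rw [this, card_sigma]
    simp
  rw [hcard, hsum] at hle
  refine le_of_mul_le_mul_left ?_ hN0
  calc N * ∑ l ∈ sep L p q, μ l = ∑ l ∈ sep L p q, N * μ l := mul_sum _ _ _
    _ ≤ ∑ l ∈ sep L p q, (n l : ℝ) := sum_le_sum fun l _ => hn1 l
    _ ≤ 46 / #Q * ∑ l, n l * √(k l : ℝ) := hle
    _ ≤ 46 / #Q * (2 * N * ∑ l, w l) := mul_le_mul_of_nonneg_left hsumk (by positivity)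
    _ = N * (92 / #Q * ∑ l, w l) := by ring

/-- If every subset of `P` contains a pair separated by few sets in a weighted sense, then pairing
points greedily and signing the pairs by the method of conditional expectations gives a balanced
coloring with small exponential moments. -/
theorem exists_balanced_coloring_exp_le {α ι : Type*} [DecidableEq α] [Fintype ι]
    (T : ι → Finset α) (lam : ι → ℝ) (C : ℕ) (P : Finset α)
    (hpair : ∀ Q ⊆ P, 2 ≤ #Q → ∀ w : ι → ℝ, (∀ i, 0 < w i) → ∃ p ∈ Q, ∃ q ∈ Q, p ≠ q ∧
      ∑ i with (p ∈ T i ↔ q ∉ T i), w i * (Real.cosh (lam i) - 1) ≤ C / #Q * ∑ i, w i)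
    (n : ℕ) : ∀ Q ⊆ P, #Q = 2 * n → ∀ w : ι → ℝ, (∀ i, 0 < w i) → ∃ χ : α → ℝ,
      (∀ p ∈ Q, χ p = 1 ∨ χ p = -1) ∧ ∑ p ∈ Q, χ p = 0 ∧
      ∑ i, w i * Real.exp (lam i * ∑ p ∈ Q, if p ∈ T i then χ p else 0) ≤
        (#Q + 1 : ℝ) ^ C * ∑ i, w i := by
  induction n with
  | zero =>
    intro Q _ hQ w _
    obtain rfl : Q = ∅ := card_eq_zero.1 (by simpa using hQ)
    exact ⟨fun _ => 1, by simp⟩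
  | succ n ih =>
    intro Q hQP hQ w hw
    obtain ⟨p, hp, q, hq, hpq, hle⟩ := hpair Q hQP (by omega) w hw
    set m : ℝ := 2 * n + 2 with hm
    have hQm : (#Q : ℝ) = m := by rw [hQ, hm]; push_cast; ring
    have hm0 : 0 < m := by positivity
    rw [hQm] at hle ⊢
    set e : ι → ℝ := fun i => (if p ∈ T i then 1 else 0) - (if q ∈ T i then 1 else 0) with he
    have hcosh : ∑ i, w i * Real.cosh (lam i * e i) ≤ (1 + C / m) * ∑ i, w i := by
      have h1 : ∀ i, w i * Real.cosh (lam i * e i) =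
          w i + if (p ∈ T i ↔ q ∉ T i) then w i * (Real.cosh (lam i) - 1) else 0 := by
        intro i
        by_cases h1 : p ∈ T i <;> by_cases h2 : q ∈ T i <;> simp [he, h1, h2] <;> ring
      rw [sum_congr rfl fun i _ => h1 i, sum_add_distrib, ← sum_filter]
      linarith
    obtain ⟨σ, hσ, hσw⟩ : ∃ σ : ℝ, (σ = 1 ∨ σ = -1) ∧
        ∑ i, w i * Real.exp (lam i * (σ * e i)) ≤ (1 + C / m) * ∑ i, w i := by
      by_contra! hcon
      have h1 := hcon 1 (Or.inl rfl)
      have h2 := hcon (-1) (Or.inr rfl)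
      have h3 : ∑ i, w i * Real.exp (lam i * (1 * e i)) +
          ∑ i, w i * Real.exp (lam i * (-1 * e i)) = 2 * ∑ i, w i * Real.cosh (lam i * e i) := by
        rw [← sum_add_distrib, mul_sum]
        refine sum_congr rfl fun i _ => ?_
        rw [Real.cosh_eq, one_mul, neg_one_mul, mul_neg]
        ring
      linarith
    have hqp : q ∈ Q.erase p := mem_erase.2 ⟨hpq.symm, hq⟩
    set R := (Q.erase p).erase q with hR
    have hQR : Q = insert p (insert q R) := by rw [hR, insert_erase hqp, insert_erase hp]
    have hqR : q ∉ R := notMem_erase _ _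
    have hpR : p ∉ insert q R := by rw [hR, insert_erase hqp]; exact notMem_erase _ _
    have hRcard : #R = 2 * n := by
      rw [hR, card_erase_of_mem hqp, card_erase_of_mem hp]; omega
    obtain ⟨χ, hχ, hχ0, hχw⟩ := ih R
      (((erase_subset _ _).trans (erase_subset _ _)).trans hQP) hRcard
      (fun i => w i * Real.exp (lam i * (σ * e i))) fun i => mul_pos (hw i) (Real.exp_pos _)
    have hpR' : p ∉ R := fun h => hpR (mem_insert_of_mem h)
    set χ' : α → ℝ := fun x => if x = p then σ else if x = q then -σ else χ x with hχ'
    have hχp : χ' p = σ := by simp [hχ']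
    have hχq : χ' q = -σ := by simp [hχ', hpq.symm]
    have hχR : ∀ x ∈ R, χ' x = χ x := fun x hx => by
      have h1 : x ≠ p := fun h => hpR' (h ▸ hx)
      have h2 : x ≠ q := fun h => hqR (h ▸ hx)
      simp [hχ', h1, h2]
    have hsum : ∀ f : α → Prop, [DecidablePred f] → (∑ x ∈ Q, if f x then χ' x else 0) =
        σ * ((if f p then 1 else 0) - (if f q then 1 else 0)) +
          ∑ x ∈ R, if f x then χ x else 0 := by
      intro f _
      rw [hQR, sum_insert hpR, sum_insert hqR, hχp, hχq,
        sum_congr rfl fun x hx => by rw [hχR x hx]]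
      split_ifs <;> ring
    refine ⟨χ', ?_, ?_, ?_⟩
    · intro x hx
      rw [hQR, mem_insert, mem_insert] at hx
      rcases hx with rfl | rfl | hx
      · rwa [hχp]
      · rw [hχq]; rcases hσ with rfl | rfl <;> simp
      · rw [hχR x hx]; exact hχ x hx
    · have := hsum fun _ => True
      simpa [hχ0] using this
    · calc ∑ i, w i * Real.exp (lam i * ∑ x ∈ Q, if x ∈ T i then χ' x else 0)
          = ∑ i, w i * Real.exp (lam i * (σ * e i)) *
              Real.exp (lam i * ∑ x ∈ R, if x ∈ T i then χ x else 0) := by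
            refine sum_congr rfl fun i _ => ?_
            rw [hsum fun x => x ∈ T i, mul_add, Real.exp_add, mul_assoc]
        _ ≤ (#R + 1 : ℝ) ^ C * ∑ i, w i * Real.exp (lam i * (σ * e i)) := hχw
        _ ≤ (m - 1) ^ C * ((1 + 1 / m) ^ C * ∑ i, w i) := by
            have h1 : (#R + 1 : ℝ) = m - 1 := by rw [hRcard, hm]; push_cast; ring
            have h2 : 1 + C / m ≤ (1 + 1 / m) ^ C := by
              have := one_add_mul_le_pow (a := 1 / m)
                (by linarith [one_div_pos.2 hm0]) C
              rwa [mul_one_div] at this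
            have h3 : 0 ≤ m - 1 := by rw [← h1]; exact add_nonneg (Nat.cast_nonneg _) zero_le_one
            rw [h1]
            refine mul_le_mul_of_nonneg_left (hσw.trans ?_) (pow_nonneg h3 _)
            exact mul_le_mul_of_nonneg_right h2 (sum_nonneg fun i _ => (hw i).le)
        _ = ((m - 1) * (1 + 1 / m)) ^ C * ∑ i, w i := by rw [mul_pow]; ring
        _ ≤ (m + 1) ^ C * ∑ i, w i := by
            have hm1 : 1 ≤ m := by rw [hm]; linarith [Nat.cast_nonneg (α := ℝ) n]
            have h1 : (m - 1) * (1 + 1 / m) ≤ m + 1 := by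
              have : (m - 1) * (1 + 1 / m) = m - 1 / m := by field_simp; ring
              rw [this]
              linarith [one_div_pos.2 hm0]
            have h2 : 0 ≤ (m - 1) * (1 + 1 / m) :=
              mul_nonneg (by linarith) (by positivity)
            exact mul_le_mul_of_nonneg_right (pow_le_pow_left₀ h2 h1 _)
              (sum_nonneg fun i _ => (hw i).le)

/-- The nonempty subsets of `P` cut off by open halfplanes whose boundary avoids `P`. -/
noncomputable def halfplaneTraces (P : Finset (ℝ × ℝ)) : Finset (Finset (ℝ × ℝ)) := by
  classical
  exact {T ∈ P.powerset | T.Nonempty ∧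
    ∃ g : ℝ × ℝ × ℝ, ∀ p ∈ P, aff g p ≠ 0 ∧ (p ∈ T ↔ 0 < aff g p)}

theorem mem_halfplaneTraces {P T : Finset (ℝ × ℝ)} : T ∈ halfplaneTraces P ↔
    T ⊆ P ∧ T.Nonempty ∧ ∃ g : ℝ × ℝ × ℝ, ∀ p ∈ P, aff g p ≠ 0 ∧ (p ∈ T ↔ 0 < aff g p) := by
  simp [halfplaneTraces]

theorem aff_convexComb (g : ℝ × ℝ × ℝ) (x y : ℝ × ℝ) {a b : ℝ} (hab : a + b = 1) :
    aff g (a • x + b • y) = a * aff g x + b * aff g y := by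
  simp only [aff, Prod.fst_add, Prod.snd_add, Prod.smul_fst, Prod.smul_snd, smul_eq_mul]
  linear_combination (-g.2.2) * hab

theorem convex_aff_pos (g : ℝ × ℝ × ℝ) : Convex ℝ {x | 0 < aff g x} := by
  intro x hx y hy a b ha hb hab
  rw [Set.mem_ofPred_eq] at *
  rw [aff_convexComb g x y hab]
  rcases ha.eq_or_lt with rfl | ha
  · obtain rfl : b = 1 := by linarith
    simpa
  · exact add_pos_of_pos_of_nonneg (mul_pos ha hx) (mul_nonneg hb hy.le)

theorem convex_aff_neg (g : ℝ × ℝ × ℝ) : Convex ℝ {x | aff g x < 0} := by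
  intro x hx y hy a b ha hb hab
  rw [Set.mem_ofPred_eq] at *
  rw [aff_convexComb g x y hab]
  rcases ha.eq_or_lt with rfl | ha
  · obtain rfl : b = 1 := by linarith
    simpa
  · exact add_neg_of_neg_of_nonpos (mul_neg_of_pos_of_neg ha hx)
      (mul_nonpos_of_nonneg_of_nonpos hb hy.le)

theorem card_le_three_of_shatters [DecidableEq (ℝ × ℝ)] {P S : Finset (ℝ × ℝ)}
    (hS : (halfplaneTraces P).Shatters S) :
    S ⊆ P ∧ #S ≤ 3 := by
  have hSP : S ⊆ P := by
    obtain ⟨T, hT, hST⟩ := hS.exists_superset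
    exact hST.trans (mem_halfplaneTraces.1 hT).1
  refine ⟨hSP, ?_⟩
  by_contra! hcard
  have hdep : ¬ AffineIndependent ℝ (fun x : S => (x : ℝ × ℝ)) := by
    intro h
    have h1 := h.card_le_finrank_succ
    have h2 := Submodule.finrank_le (vectorSpan ℝ (Set.range fun x : S => (x : ℝ × ℝ)))
    have h3 : Module.finrank ℝ (ℝ × ℝ) = 2 := by simp
    rw [Fintype.card_coe] at h1
    omega
  classical
  obtain ⟨I, x, hx1, hx2⟩ := Convex.radon_partition hdep
  obtain ⟨T, hT, hST⟩ := hS (t := {y ∈ S | ∃ h : y ∈ S, (⟨y, h⟩ : S) ∈ I}) (filter_subset _ _)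
  obtain ⟨-, -, g, hg⟩ := mem_halfplaneTraces.1 hT
  have hmem : ∀ y : S, y ∈ I ↔ (y : ℝ × ℝ) ∈ T := by
    intro y
    have h1 := Finset.ext_iff.1 hST (y : ℝ × ℝ)
    rw [mem_inter, mem_filter] at h1
    have hy := y.2
    constructor
    · intro h
      exact (h1.2 ⟨hy, hy, h⟩).2
    · intro h
      exact (h1.1 ⟨hy, h⟩).2.2
  have hpos : 0 < aff g x := by
    refine convexHull_min (t := {x | 0 < aff g x}) ?_ (convex_aff_pos g) hx1
    rintro _ ⟨y, hy, rfl⟩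
    exact (hg _ (hSP y.2)).2.1 ((hmem y).1 hy)
  have hneg : aff g x < 0 := by
    refine convexHull_min (t := {x | aff g x < 0}) ?_ (convex_aff_neg g) hx2
    rintro _ ⟨y, hy, rfl⟩
    have h := hg _ (hSP y.2)
    exact lt_of_le_of_ne (not_lt.1 fun h' => hy ((hmem y).2 (h.2.2 h'))) h.1
  exact lt_asymm hpos hneg

theorem card_halfplaneTraces_le (P : Finset (ℝ × ℝ)) : #(halfplaneTraces P) ≤ (#P + 1) ^ 3 := by
  classical
  refine (card_le_card_shatterer _).trans ?_
  have hsub : (halfplaneTraces P).shatterer ⊆ (range 4).biUnion fun j => P.powersetCard j := by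
    intro S hS
    obtain ⟨h1, h2⟩ := card_le_three_of_shatters (mem_shatterer.1 hS)
    exact mem_biUnion.2 ⟨#S, mem_range.2 (by omega), mem_powersetCard.2 ⟨h1, rfl⟩⟩
  refine (card_le_card hsub).trans (card_biUnion_le.trans ?_)
  simp only [card_powersetCard, sum_range_succ, range_zero, sum_empty]
  have h2 := Nat.choose_le_pow (#P) 2
  have h3 := Nat.choose_le_pow (#P) 3
  simp only [Nat.choose_zero_right, Nat.choose_one_right]
  nlinarith

theorem cosh_sub_one_le_sq {x : ℝ} (hx : x ^ 2 ≤ 1) : Real.cosh x - 1 ≤ x ^ 2 := by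
  have h0 : |x ^ 2 / 2| = x ^ 2 / 2 := abs_of_nonneg (by positivity)
  have h1 := Real.abs_exp_sub_one_le (x := x ^ 2 / 2) (by rw [h0]; linarith)
  rw [h0] at h1
  linarith [Real.cosh_le_exp_half_sq x, le_abs_self (Real.exp (x ^ 2 / 2) - 1)]

/-- Any closed halfplane can be shifted outwards so that its boundary avoids `P`, without changing
its trace on `P`. -/
theorem filter_mem_halfplaneTraces (P : Finset (ℝ × ℝ)) (a b c : ℝ)
    (hne : {x ∈ P | 0 ≤ a * x.1 + b * x.2 + c}.Nonempty) :
    {x ∈ P | 0 ≤ a * x.1 + b * x.2 + c} ∈ halfplaneTraces P := by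
  have hev : ∀ᶠ ε in nhdsWithin (0 : ℝ) (Set.Ioi 0), ∀ x ∈ P,
      a * x.1 + b * x.2 + c < 0 → a * x.1 + b * x.2 + (c + ε) < 0 := by
    rw [Filter.eventually_all_finset]
    intro x _
    rw [Filter.eventually_imp_distrib_left]
    intro hx
    have hc : Continuous fun ε : ℝ => a * x.1 + b * x.2 + (c + ε) := by fun_prop
    refine nhdsWithin_le_nhds (hc.continuousAt.eventually (gt_mem_nhds ?_))
    simpa using hx
  obtain ⟨ε, hε, hε0⟩ := (hev.and self_mem_nhdsWithin).exists
  refine mem_halfplaneTraces.2 ⟨filter_subset _ _, hne, (a, b, c + ε), fun p hp => ?_⟩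
  simp only [aff, mem_filter, hp, true_and]
  rcases lt_or_ge (a * p.1 + b * p.2 + c) 0 with h | h
  · have := hε p hp h
    exact ⟨this.ne, iff_of_false (not_le.2 h) (not_lt.2 this.le)⟩
  · have : 0 < a * p.1 + b * p.2 + (c + ε) := by linarith
    exact ⟨this.ne', iff_of_true h this⟩

/-- A balanced coloring whose discrepancy on each trace `T` is `O(|T|^{1/4} log n)`. -/
theorem exists_balanced_coloring_halfplaneTraces (P : Finset (ℝ × ℝ)) (hP2 : 2 ≤ #P)
    (hPe : Even #P) :
    ∃ χ : ℝ × ℝ → ℝ, (∀ p ∈ P, χ p = 1 ∨ χ p = -1) ∧ ∑ p ∈ P, χ p = 0 ∧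
      ∀ T ∈ halfplaneTraces P, |∑ p ∈ T, χ p| ≤
        192 * (#T : ℝ) ^ ((1 : ℝ) / 4) * Real.log #P := by
  classical
  have hex : ∀ i : halfplaneTraces P × Bool, ∃ g : ℝ × ℝ × ℝ,
      ∀ p ∈ P, aff g p ≠ 0 ∧ (p ∈ (i.1 : Finset (ℝ × ℝ)) ↔ 0 < aff g p) :=
    fun i => (mem_halfplaneTraces.1 i.1.2).2.2
  choose L hL using hex
  set T : halfplaneTraces P × Bool → Finset (ℝ × ℝ) := fun i => i.1 with hT
  have hTne : ∀ i, 0 < #(T i) := fun i => card_pos.2 (mem_halfplaneTraces.1 i.1.2).2.1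
  set lam : halfplaneTraces P × Bool → ℝ := fun i =>
    (if i.2 then 1 else -1) * ((#(T i) : ℝ) ^ ((1 : ℝ) / 4))⁻¹ with hlam
  have hlam2 : ∀ i, lam i ^ 2 = 1 / √(#(T i) : ℝ) := by
    intro i
    have h1 : (if i.2 then (1 : ℝ) else -1) ^ 2 = 1 := by split_ifs <;> norm_num
    rw [hlam]
    simp only
    rw [mul_pow, h1, inv_pow, ← Real.rpow_natCast, ← Real.rpow_mul (Nat.cast_nonneg _),
      Real.sqrt_eq_rpow, one_mul, one_div]
    norm_num
  have hpair : ∀ Q ⊆ P, 2 ≤ #Q → ∀ w : halfplaneTraces P × Bool → ℝ, (∀ i, 0 < w i) →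
      ∃ p ∈ Q, ∃ q ∈ Q, p ≠ q ∧
        ∑ i with (p ∈ T i ↔ q ∉ T i), w i * (Real.cosh (lam i) - 1) ≤
          (92 : ℕ) / #Q * ∑ i, w i := by
    intro Q hQP hQ w hw
    obtain ⟨p, hp, q, hq, hpq, hle⟩ := exists_pair_weight_sep_le (L := L) Q hQ
      (fun l p hp => (hL l p (hQP hp)).1) hw
    refine ⟨p, hp, q, hq, hpq, ?_⟩
    have hsep : ({i | p ∈ T i ↔ q ∉ T i} : Finset _) = sep L p q := by
      ext i
      have h1 := hL i p (hQP hp)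
      have h2 := hL i q (hQP hq)
      rw [mem_filter, mem_sep, and_iff_right (mem_univ i)]
      change (p ∈ (i.1 : Finset (ℝ × ℝ)) ↔ ¬ q ∈ (i.1 : Finset (ℝ × ℝ))) ↔ _
      rw [h1.2, h2.2]
      rcases h1.1.lt_or_gt with h3 | h3 <;> rcases h2.1.lt_or_gt with h4 | h4
      · exact iff_of_false (fun h => h3.not_gt (h.2 h4.not_gt)) (mul_pos_of_neg_of_neg h3 h4).not_gt
      · simp [h3.le, h4, mul_neg_of_neg_of_pos h3 h4]
      · simp [h3, h4.le, mul_neg_of_pos_of_neg h3 h4]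
      · simp [h3, h4, (mul_pos h3 h4).le]
    rw [hsep]
    refine le_trans (sum_le_sum fun i hi => ?_) hle
    rw [div_eq_mul_one_div]
    refine mul_le_mul_of_nonneg_left ?_ (hw i).le
    have hTi : (1 : ℝ) ≤ √(#(T i) : ℝ) := Real.one_le_sqrt.2 (by exact_mod_cast hTne i)
    refine (cosh_sub_one_le_sq ?_).trans ?_
    · rw [hlam2]
      exact (div_le_one (by linarith)).2 hTi
    · rw [hlam2]
      refine one_div_le_one_div_of_le (Real.sqrt_pos.2 ?_) (Real.sqrt_le_sqrt ?_)
      · rw [Nat.cast_pos, card_pos]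
        rcases mul_neg_iff.1 (mem_sep.1 hi) with h | h
        · exact ⟨p, mem_filter.2 ⟨hp, h.1⟩⟩
        · exact ⟨q, mem_filter.2 ⟨hq, h.2⟩⟩
      · rw [Nat.cast_le]
        refine card_le_card fun x hx => ?_
        obtain ⟨hx, h⟩ := mem_filter.1 hx
        exact (hL i x (hQP hx)).2.2 h
  obtain ⟨n, hn⟩ := hPe
  obtain ⟨χ, hχ, hχ0, hχw⟩ := exists_balanced_coloring_exp_le T lam 92 P hpair n P Subset.rfl
    (by omega) (fun _ => 1) fun _ => one_pos
  refine ⟨χ, hχ, hχ0, fun S hS => ?_⟩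
  obtain ⟨N, hN⟩ : ∃ N : ℝ, N = #P := ⟨_, rfl⟩
  rw [← hN] at hχw ⊢
  have hN2 : 2 ≤ N := by rw [hN]; exact_mod_cast hP2
  have hcard : ∑ _i : halfplaneTraces P × Bool, (1 : ℝ) ≤ (N + 1) ^ 4 := by
    rw [sum_const, card_univ, Fintype.card_prod, Fintype.card_coe, Fintype.card_bool, nsmul_eq_mul,
      mul_one, Nat.cast_mul]
    have h1 : (#(halfplaneTraces P) : ℝ) ≤ (N + 1) ^ 3 := by
      rw [hN]; exact_mod_cast card_halfplaneTraces_le P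
    calc (#(halfplaneTraces P) : ℝ) * (2 : ℕ) ≤ (N + 1) ^ 3 * (N + 1) :=
          mul_le_mul h1 (by push_cast; linarith) (by positivity) (by positivity)
      _ = (N + 1) ^ 4 := by ring
  have hsumS : (∑ p ∈ P, if p ∈ S then χ p else 0) = ∑ p ∈ S, χ p := by
    rw [← sum_filter, filter_mem_eq_inter,
      inter_eq_right.2 (mem_halfplaneTraces.1 hS).1]
  have hbound : ∀ β : Bool, lam (⟨S, hS⟩, β) * ∑ p ∈ S, χ p ≤ 192 * Real.log N := by
    intro β
    have h1 : Real.exp (lam (⟨S, hS⟩, β) * ∑ p ∈ S, χ p) ≤ (N + 1) ^ 96 := by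
      calc Real.exp (lam (⟨S, hS⟩, β) * ∑ p ∈ S, χ p)
          = 1 * Real.exp (lam (⟨S, hS⟩, β) * ∑ p ∈ P, if p ∈ T (⟨S, hS⟩, β) then χ p else 0) := by
            rw [one_mul, ← hsumS]
        _ ≤ ∑ i, 1 * Real.exp (lam i * ∑ p ∈ P, if p ∈ T i then χ p else 0) :=
            single_le_sum (f := fun i =>
              1 * Real.exp (lam i * ∑ p ∈ P, if p ∈ T i then χ p else 0))
              (fun i _ => by positivity) (mem_univ ((⟨S, hS⟩, β) : halfplaneTraces P × Bool))
        _ ≤ (N + 1) ^ 92 * (N + 1) ^ 4 :=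
            hχw.trans (mul_le_mul_of_nonneg_left hcard (by positivity))
        _ = (N + 1) ^ 96 := by ring
    have h2 : (N + 1) ^ 96 ≤ N ^ 192 := by
      rw [show 192 = 2 * 96 by norm_num, pow_mul]
      exact pow_le_pow_left₀ (by linarith) (by nlinarith) _
    have h3 := (Real.le_log_iff_exp_le (by positivity)).2 (h1.trans h2)
    rwa [Real.log_pow] at h3
  have hk : 0 < (#S : ℝ) ^ ((1 : ℝ) / 4) :=
    Real.rpow_pos_of_pos (Nat.cast_pos.2 (card_pos.2 (mem_halfplaneTraces.1 hS).2.1)) _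
  have h1 := hbound true
  have h2 := hbound false
  simp only [hlam, hT, if_true, Bool.false_eq_true, if_false] at h1 h2
  set K := (#S : ℝ) ^ ((1 : ℝ) / 4) with hK
  set D := ∑ p ∈ S, χ p
  have h3 : K⁻¹ * |D| ≤ 192 * Real.log N := by
    rcases abs_cases D with h | h <;> rw [h.1] <;> linarith
  rw [inv_mul_le_iff₀ hk] at h3
  linarith

end HalfplaneDiscrepancy

/-- Every finite planar point set of even size `n ≥ 2` admits a balanced
`±1`-coloring such that every closed halfplane `h` has discrepancy at most
`C·|P ∩ h|^{1/4}·log n`. -/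
theorem balanced_low_discrepancy_coloring :
    ∃ C : ℝ, 0 < C ∧
      ∀ P : Finset (ℝ × ℝ), 2 ≤ P.card → Even P.card →
        ∃ χ : ℝ × ℝ → ℝ,
          (∀ p ∈ P, χ p = 1 ∨ χ p = -1) ∧
          2 * ((↑P : Set (ℝ × ℝ)) ∩ {p | χ p = 1}).ncard = P.card ∧
          2 * ((↑P : Set (ℝ × ℝ)) ∩ {p | χ p = -1}).ncard = P.card ∧
          ∀ a b c : ℝ, (a, b) ≠ (0, 0) →
            |∑ p ∈ P, Set.indicator {x : ℝ × ℝ | 0 ≤ a * x.1 + b * x.2 + c} χ p| ≤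
              C * ((((↑P : Set (ℝ × ℝ)) ∩
                    {x : ℝ × ℝ | 0 ≤ a * x.1 + b * x.2 + c}).ncard : ℝ) ^ ((1 : ℝ) / 4)) *
                Real.log (P.card : ℝ) := by
  classical
  refine ⟨192, by norm_num, fun P hP2 hPe => ?_⟩
  obtain ⟨χ, hχ, hχ0, hdisc⟩ := HalfplaneDiscrepancy.exists_balanced_coloring_halfplaneTraces P hP2 hPe
  have hncard : ∀ f : ℝ × ℝ → Prop, ((↑P : Set (ℝ × ℝ)) ∩ {p | f p}).ncard = #{p ∈ P | f p} := by
    intro f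
    rw [← Set.ncard_coe_finset]
    congr 1
    ext x
    simp
  have hadd : #{p ∈ P | χ p = 1} + #{p ∈ P | χ p = -1} = #P := by
    rw [← card_filter_add_card_filter_not (s := P) fun p => χ p = 1]
    congr 2
    refine filter_congr fun p hp => ?_
    rcases hχ p hp with h | h <;> rw [h] <;> norm_num
  have heq : #{p ∈ P | χ p = 1} = #{p ∈ P | χ p = -1} := by
    have h1 : ∑ p ∈ P, χ p =
        ∑ p ∈ P, ((if χ p = 1 then (1 : ℝ) else 0) - if χ p = -1 then (1 : ℝ) else 0) := by
      refine sum_congr rfl fun p hp => ?_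
      rcases hχ p hp with h | h <;> rw [h] <;> norm_num
    rw [hχ0, sum_sub_distrib, sum_boole, sum_boole] at h1
    exact_mod_cast (sub_eq_zero.1 h1.symm)
  refine ⟨χ, hχ, ?_, ?_, fun a b c _ => ?_⟩
  · rw [hncard]; omega
  · rw [hncard]; omega
  · rw [hncard fun x => 0 ≤ a * x.1 + b * x.2 + c]
    have hsum : ∑ p ∈ P, Set.indicator {x : ℝ × ℝ | 0 ≤ a * x.1 + b * x.2 + c} χ p =
        ∑ p ∈ P with 0 ≤ a * p.1 + b * p.2 + c, χ p := by
      rw [sum_filter]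
      exact sum_congr rfl fun p _ => by simp [Set.indicator_apply]
    rw [hsum]
    rcases ({x ∈ P | 0 ≤ a * x.1 + b * x.2 + c}).eq_empty_or_nonempty with h | h
    · rw [h]; simp
    · exact hdisc _ (HalfplaneDiscrepancy.filter_mem_halfplaneTraces P a b c h)
end

section
/- There is an absolute constant C > 0 with the following property. For every nonempty finite set P of points in ℝ² and all parameters 0 < α < 1 and 0 < ν < 1, there exists a nonempty subset Z ⊆ P with |Z| ≤ C·(1/(α^{4/3}·ν))·log^{4/3}(2/(α·ν)) such that Z is a (ν,α)-sample for P with respect to closed halfplane ranges; that is, for every closed halfplane h in ℝ², d_ν(X̄(h,Z), X̄(h,P)) < α. -/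
/-- The measure of a set `h` in a finite planar point set `Z`: `|Z ∩ h| / |Z|`. -/
noncomputable def meas2 (h : Set (ℝ × ℝ)) (Z : Finset (ℝ × ℝ)) : ℝ :=
  (((↑Z : Set (ℝ × ℝ)) ∩ h).ncard : ℝ) / (Z.card : ℝ)

/-- The distance `d_ν(a,b) = |a − b| / (a + b + ν)`. -/
noncomputable def dnu (ν a b : ℝ) : ℝ := |a - b| / (a + b + ν)

section HalfplaneSamples

open Finset Filter Topology

/-- Among the elements of `U` there is a set of `r` elements on which `f` is smallest. -/
lemma exists_lower_subset {ι : Type*} [DecidableEq ι] (U : Finset ι) (f : ι → ℝ) (r : ℕ)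
    (hr : r ≤ U.card) :
    ∃ A ⊆ U, A.card = r ∧ ∀ i ∈ A, ∀ j ∈ U, f j < f i → j ∈ A := by
  induction r with
  | zero => exact ⟨∅, by simp⟩
  | succ r ih =>
    obtain ⟨A, hAU, hA, hlow⟩ := ih (by omega)
    have hne : (U \ A).Nonempty := by
      rw [← card_pos, card_sdiff_of_subset hAU]
      omega
    obtain ⟨x, hx, hmin⟩ := exists_min_image (U \ A) f hne
    rw [Finset.mem_sdiff] at hx
    refine ⟨insert x A, insert_subset hx.1 hAU, by rw [card_insert_of_notMem hx.2, hA], ?_⟩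
    intro i hi j hj hji
    rw [mem_insert] at hi ⊢
    by_contra hcon
    push Not at hcon
    have := hmin j (Finset.mem_sdiff.2 ⟨hj, hcon.2⟩)
    rcases hi with rfl | hi
    · linarith
    · exact hcon.2 (hlow i hi j hj hji)

/-- The affine function `b (y - s x - t)`, whose zero set is the line of slope `s` and
intercept `t`. -/
def lineForm (b s t : ℝ) (p : ℝ × ℝ) : ℝ := b * (p.2 - s * p.1 - t)

/-- The abscissa of the intersection of the `i`-th and the `j`-th line. -/
noncomputable def crossX {ι : Type*} (s t : ι → ℝ) (i j : ι) : ℝ := (t j - t i) / (s i - s j)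

/-- The intersection point of the `i`-th and the `j`-th line. -/
noncomputable def crossPt {ι : Type*} (s t : ι → ℝ) (i j : ι) : ℝ × ℝ :=
  (crossX s t i j, s i * crossX s t i j + t i)

lemma lineForm_on_line {ι : Type*} (b s t : ι → ℝ) {i j : ι} (h : s i ≠ s j) (x : ℝ) :
    lineForm (b j) (s j) (t j) (x, s i * x + t i) =
      b j * ((s i - s j) * (x - crossX s t i j)) := by
  have : s i - s j ≠ 0 := sub_ne_zero.2 h
  unfold lineForm crossX
  field_simp
  ring

lemma no_sign_change {u g g' : ℝ} (h0 : u * g' < 0) (h1 : (g - u) ^ 2 ≤ u ^ 2)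
    (h2 : (g' - g) ^ 2 ≤ g ^ 2) : False := by
  have hgu : 0 ≤ g * u := by linarith [sq_nonneg g, sub_sq g u]
  have hgg : 0 ≤ g' * g := by linarith [sq_nonneg g', sub_sq g' g]
  have h3 : 0 ≤ g ^ 2 * (u * g') := by linarith [mul_nonneg hgu hgg]
  have hg : g = 0 := by
    by_contra hg
    exact absurd h3 (not_le.2 (mul_neg_of_pos_of_neg (by positivity) h0))
  rw [hg, sub_zero, zero_pow two_ne_zero] at h2
  have : g' = 0 := pow_eq_zero_iff two_ne_zero |>.1 (le_antisymm h2 (sq_nonneg g'))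
  rw [this, mul_zero] at h0
  exact lt_irrefl _ h0

section
variable {ι : Type*} [Fintype ι] [DecidableEq ι]

/-- On each line, at most `2 K` of the crossings with other lines lie in at most `K` of the
closed halfplanes. -/
lemma card_shallow_crossings_on_line (b s t : ι → ℝ) (hb : ∀ i, b i ≠ 0)
    (hs : Function.Injective s) (K : ℕ) (i : ι) :
    (univ.filter fun j => j ≠ i ∧
      (univ.filter fun l => 0 ≤ lineForm (b l) (s l) (t l) (crossPt s t i j)).card ≤ K).card
      ≤ 2 * K := by
  have key : ∀ τ : ℝ, (τ = 1 ∨ τ = -1) → (univ.filter fun j => (j ≠ i ∧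
      (univ.filter fun l => 0 ≤ lineForm (b l) (s l) (t l) (crossPt s t i j)).card ≤ K) ∧
        0 < τ * (b j * (s i - s j))).card ≤ K := by
    intro τ hτ
    set R := univ.filter fun j => (j ≠ i ∧
      (univ.filter fun l => 0 ≤ lineForm (b l) (s l) (t l) (crossPt s t i j)).card ≤ K) ∧
        0 < τ * (b j * (s i - s j)) with hR
    rcases R.eq_empty_or_nonempty with h | h
    · simp [h]
    · obtain ⟨j, hj, hmax⟩ := exists_max_image R (fun j => τ * crossX s t i j) h
      have hj' := (mem_filter.1 hj).2
      refine le_trans (card_le_card ?_) hj'.1.2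
      intro l hl
      have hl' := (mem_filter.1 hl).2
      have hm := hmax l hl
      rw [mem_filter]
      refine ⟨mem_univ _, ?_⟩
      have hsl : s i ≠ s l := fun e => hl'.1.1 (hs e).symm
      rw [crossPt, lineForm_on_line b s t hsl]
      have h1 : 0 ≤ (τ * (b l * (s i - s l))) * (τ * crossX s t i j - τ * crossX s t i l) :=
        mul_nonneg hl'.2.le (by linarith)
      rcases hτ with rfl | rfl <;> nlinarith
  calc _ ≤ ((univ.filter fun j => (j ≠ i ∧
      (univ.filter fun l => 0 ≤ lineForm (b l) (s l) (t l) (crossPt s t i j)).card ≤ K) ∧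
        0 < (1 : ℝ) * (b j * (s i - s j))) ∪ (univ.filter fun j => (j ≠ i ∧
      (univ.filter fun l => 0 ≤ lineForm (b l) (s l) (t l) (crossPt s t i j)).card ≤ K) ∧
        0 < (-1 : ℝ) * (b j * (s i - s j)))).card := by
        apply card_le_card
        intro j hj
        have hj' := (mem_filter.1 hj).2
        have hne : b j * (s i - s j) ≠ 0 :=
          mul_ne_zero (hb j) (sub_ne_zero.2 fun e => hj'.1 (hs e).symm)
        rw [mem_union, mem_filter, mem_filter]
        rcases lt_or_gt_of_ne hne with h | h
        · exact Or.inr ⟨mem_univ _, hj', by linarith⟩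
        · exact Or.inl ⟨mem_univ _, hj', by linarith⟩
    _ ≤ K + K := (card_union_le _ _).trans (add_le_add (key 1 (Or.inl rfl)) (key (-1) (Or.inr rfl)))
    _ = 2 * K := by ring

/-- A point on none of the lines sees at least `r ^ 2` crossings that are separated from it by at
most `2 r` lines. -/
lemma exists_near_crossings (b s t : ι → ℝ) (hs : Function.Injective s) (r : ℕ)
    (hr : r + 1 ≤ Fintype.card ι) (p : ℝ × ℝ) (hp : ∀ i, lineForm (b i) (s i) (t i) p ≠ 0) :
    ∃ T : Finset (Σ _ : ι, ι), T.card = r * r ∧ ∀ e ∈ T, e.2 ≠ e.1 ∧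
      (univ.filter fun l => lineForm (b l) (s l) (t l) p *
        lineForm (b l) (s l) (t l) (crossPt s t e.1 e.2) < 0).card ≤ 2 * r := by
  obtain ⟨A, -, hAc, hA⟩ := exists_lower_subset (univ : Finset ι)
    (fun l => |s l * p.1 + t l - p.2|) r (by rw [card_univ]; omega)
  have hB : ∀ i : ι, ∃ B ⊆ univ.erase i, B.card = r ∧ ∀ j ∈ B, ∀ l ∈ univ.erase i,
      |crossX s t i l - p.1| < |crossX s t i j - p.1| → l ∈ B := fun i =>
    exists_lower_subset (univ.erase i) (fun l => |crossX s t i l - p.1|) r (by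
      rw [card_erase_of_mem (mem_univ _), card_univ]; omega)
  choose B hBi hBc hB using hB
  refine ⟨A.sigma B, ?_, ?_⟩
  · rw [card_sigma, sum_congr rfl (fun i _ => hBc i), sum_const, hAc, smul_eq_mul]
  rintro ⟨i, j⟩ hij
  rw [mem_sigma] at hij
  obtain ⟨hiA, hjB⟩ := hij
  refine ⟨(mem_erase.1 (hBi i hjB)).1, ?_⟩
  have hsub : (univ.filter fun l => lineForm (b l) (s l) (t l) p *
        lineForm (b l) (s l) (t l) (crossPt s t i j) < 0) ⊆ A ∪ B i := by
    intro l hl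
    have hl := (mem_filter.1 hl).2
    rw [mem_union]
    by_contra hcon
    push Not at hcon
    have h1 : |s i * p.1 + t i - p.2| ≤ |s l * p.1 + t l - p.2| := by
      by_contra! h
      exact hcon.1 (hA i hiA l (mem_univ _) h)
    have hli : l ≠ i := by
      rintro rfl
      exact hcon.1 hiA
    have h2 : |crossX s t i j - p.1| ≤ |crossX s t i l - p.1| := by
      by_contra! h
      exact hcon.2 (hB i j hjB l (mem_erase.2 ⟨hli, mem_univ _⟩) h)
    have hsil : s i ≠ s l := fun e => hli (hs e).symm
    have hd : s i - s l ≠ 0 := sub_ne_zero.2 hsil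
    have hpl := hp l
    rw [crossPt, lineForm_on_line b s t hsil] at hl
    set x := crossX s t i j
    set y := crossX s t i l with hy
    have hyd : (s i - s l) * y = t l - t i := by
      rw [hy, crossX]; field_simp
    unfold lineForm at hl hpl
    set u := p.2 - s l * p.1 - t l with hu
    set g := (s i - s l) * (p.1 - y) with hg
    set g' := (s i - s l) * (x - y) with hg'
    have hbb : 0 < b l * b l := mul_self_pos.2 (left_ne_zero_of_mul hpl)
    have e1 : u * g' < 0 := by
      by_contra! h
      nlinarith [mul_nonneg hbb.le h]
    have e2 : s i * p.1 + t i - p.2 = g - u := by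
      rw [hu, hg, mul_sub, hyd]; ring
    have e3 : s l * p.1 + t l - p.2 = - u := by rw [hu]; ring
    rw [e2, e3, abs_neg] at h1
    have h1' := sq_le_sq.2 h1
    have h2' := sq_le_sq.2 h2
    have h3 : (g' - g) ^ 2 ≤ g ^ 2 := by
      have : (s i - s l) ^ 2 * (x - p.1) ^ 2 ≤ (s i - s l) ^ 2 * (y - p.1) ^ 2 := by
        gcongr
      calc (g' - g) ^ 2 = (s i - s l) ^ 2 * (x - p.1) ^ 2 := by rw [hg, hg']; ring
        _ ≤ (s i - s l) ^ 2 * (y - p.1) ^ 2 := this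
        _ = g ^ 2 := by rw [hg]; ring
    exact no_sign_change e1 h1' h3
  calc _ ≤ (A ∪ B i).card := card_le_card hsub
    _ ≤ A.card + (B i).card := card_union_le _ _
    _ = 2 * r := by rw [hAc, hBc]; ring

/-- Packing lemma for points that lie in few halfplanes, for lines in general position. -/
lemma shallow_packing_simple (b s t : ι → ℝ) (hb : ∀ i, b i ≠ 0)
    (hs : Function.Injective s)
    (hgen : ∀ i j l, i ≠ j → l ≠ i → l ≠ j →
      lineForm (b l) (s l) (t l) (crossPt s t i j) ≠ 0)
    (r K : ℕ) (hr : r + 1 ≤ Fintype.card ι) (V : Finset (ℝ × ℝ))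
    (hV : ∀ p ∈ V, ∀ i, lineForm (b i) (s i) (t i) p ≠ 0)
    (hK : ∀ p ∈ V, (univ.filter fun l => 0 < lineForm (b l) (s l) (t l) p).card ≤ K)
    (hsep : ∀ p ∈ V, ∀ q ∈ V, p ≠ q → 4 * r + 3 ≤
      (univ.filter fun l => lineForm (b l) (s l) (t l) p * lineForm (b l) (s l) (t l) q < 0).card) :
    V.card * (r * r) ≤ Fintype.card ι * (2 * (K + 2 * r + 2)) := by
  choose! T hTc hT using fun p (hp : p ∈ V) => exists_near_crossings b s t hs r hr p (hV p hp)
  have hzero : ∀ i j, j ≠ i →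
      (univ.filter fun l => lineForm (b l) (s l) (t l) (crossPt s t i j) = 0).card ≤ 2 := by
    intro i j hij
    refine le_trans (card_le_card (t := {i, j}) ?_) card_le_two
    intro l hl
    have hl := (mem_filter.1 hl).2
    rw [mem_insert, mem_singleton]
    by_contra! h
    exact hgen i j l hij.symm h.1 h.2 hl
  have hdisj : ∀ p ∈ V, ∀ q ∈ V, p ≠ q → Disjoint (T p) (T q) := by
    intro p hp q hq hpq
    rw [disjoint_left]
    intro e hep heq
    have h1 := hT p hp e hep
    have h2 := hT q hq e heq
    have h3 := hsep p hp q hq hpq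
    have h4 : (univ.filter fun l =>
        lineForm (b l) (s l) (t l) p * lineForm (b l) (s l) (t l) q < 0) ⊆
        ((univ.filter fun l => lineForm (b l) (s l) (t l) p *
          lineForm (b l) (s l) (t l) (crossPt s t e.1 e.2) < 0) ∪
        (univ.filter fun l => lineForm (b l) (s l) (t l) q *
          lineForm (b l) (s l) (t l) (crossPt s t e.1 e.2) < 0)) ∪
        (univ.filter fun l => lineForm (b l) (s l) (t l) (crossPt s t e.1 e.2) = 0) := by
      intro l hl
      simp only [mem_filter, mem_union, mem_univ, true_and] at hl ⊢
      rcases lt_trichotomy (lineForm (b l) (s l) (t l) (crossPt s t e.1 e.2)) 0 with h | h | h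
      · left
        rcases mul_neg_iff.1 hl with h' | h'
        · left; nlinarith
        · right; nlinarith
      · right; exact h
      · left
        rcases mul_neg_iff.1 hl with h' | h'
        · right; nlinarith
        · left; nlinarith
    have h5 := (card_le_card h4).trans (card_union_le _ _)
    have h6 := card_union_le (univ.filter fun l => lineForm (b l) (s l) (t l) p *
          lineForm (b l) (s l) (t l) (crossPt s t e.1 e.2) < 0)
        (univ.filter fun l => lineForm (b l) (s l) (t l) q *
          lineForm (b l) (s l) (t l) (crossPt s t e.1 e.2) < 0)
    have h7 := hzero e.1 e.2 h1.1
    omega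
  calc V.card * (r * r) = ∑ p ∈ V, (T p).card := by
        rw [sum_congr rfl hTc, sum_const, smul_eq_mul]
    _ = (V.biUnion T).card := (card_biUnion hdisj).symm
    _ ≤ ((univ : Finset ι).sigma fun i => univ.filter fun j => j ≠ i ∧
          (univ.filter fun l => 0 ≤ lineForm (b l) (s l) (t l) (crossPt s t i j)).card
            ≤ K + 2 * r + 2).card := by
        apply card_le_card
        intro e he
        obtain ⟨p, hp, hep⟩ := mem_biUnion.1 he
        have h1 := hT p hp e hep
        rw [mem_sigma, mem_filter]
        refine ⟨mem_univ _, mem_univ _, h1.1, ?_⟩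
        have h4 : (univ.filter fun l => 0 ≤ lineForm (b l) (s l) (t l) (crossPt s t e.1 e.2)) ⊆
          ((univ.filter fun l => 0 < lineForm (b l) (s l) (t l) p) ∪
          (univ.filter fun l => lineForm (b l) (s l) (t l) p *
            lineForm (b l) (s l) (t l) (crossPt s t e.1 e.2) < 0)) ∪
          (univ.filter fun l => lineForm (b l) (s l) (t l) (crossPt s t e.1 e.2) = 0) := by
          intro l hl
          simp only [mem_filter, mem_union, mem_univ, true_and] at hl ⊢
          rcases hl.eq_or_lt with h | h
          · right; exact h.symm
          · left
            rcases lt_or_gt_of_ne (hV p hp l) with h' | h'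
            · right; nlinarith
            · left; exact h'
        have h5 := (card_le_card h4).trans (card_union_le _ _)
        have h6 := card_union_le (univ.filter fun l => 0 < lineForm (b l) (s l) (t l) p)
          (univ.filter fun l => lineForm (b l) (s l) (t l) p *
            lineForm (b l) (s l) (t l) (crossPt s t e.1 e.2) < 0)
        have h7 := hzero e.1 e.2 h1.1
        have h8 := hK p hp
        omega
    _ ≤ ∑ _i : ι, 2 * (K + 2 * r + 2) := by
        rw [card_sigma]
        exact sum_le_sum fun i _ => card_shallow_crossings_on_line b s t hb hs _ i
    _ = _ := by rw [sum_const, smul_eq_mul, card_univ]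

end

/-- `S` is cut out of `P` by a closed halfplane (or is all of `P`, or empty). -/
def IsTrace (P S : Finset (ℝ × ℝ)) : Prop :=
  S ⊆ P ∧ ∃ a b c : ℝ, ∀ p ∈ P, p ∈ S ↔ 0 ≤ a * p.1 + b * p.2 + c

/-- A trace is cut out strictly, by an open set of non-vertical lines. -/
lemma IsTrace.exists_open_lines {P S : Finset (ℝ × ℝ)} (h : IsTrace P S) :
    ∃ b s₀ t₀ ε : ℝ, b ≠ 0 ∧ 0 < ε ∧ ∀ s t, |s - s₀| < ε → |t - t₀| < ε →
      ∀ p ∈ P, (p ∈ S → 0 < lineForm b s t p) ∧ (p ∉ S → lineForm b s t p < 0) := by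
  classical
  obtain ⟨-, a, b, c, habc⟩ := h
  set σ : ℝ × ℝ → ℝ := fun p => if p ∈ S then 1 else -1 with hσ
  have h1 : ∀ᶠ e in 𝓝[>] (0 : ℝ), ∀ p ∈ P, 0 < σ p * (a * p.1 + b * p.2 + (c + e)) := by
    rw [eventually_all_finset]
    intro p hp
    by_cases hpS : p ∈ S
    · filter_upwards [self_mem_nhdsWithin] with e he
      have := (habc p hp).1 hpS
      have he : 0 < e := he
      simp only [hσ, hpS, if_true]
      linarith
    · have : a * p.1 + b * p.2 + c < 0 := by
        by_contra! h
        exact hpS ((habc p hp).2 h)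
      have h2 : ∀ᶠ e in 𝓝[>] (0 : ℝ), e < -(a * p.1 + b * p.2 + c) :=
        (eventually_lt_nhds (by linarith)).filter_mono nhdsWithin_le_nhds
      filter_upwards [h2] with e he
      simp only [hσ, hpS, if_false]
      linarith
  obtain ⟨e, he⟩ := h1.exists
  have h2 : ∀ᶠ b' in 𝓝[≠] b, ∀ p ∈ P, 0 < σ p * (a * p.1 + b' * p.2 + (c + e)) := by
    rw [eventually_all_finset]
    intro p hp
    have hc : Continuous fun b' : ℝ => σ p * (a * p.1 + b' * p.2 + (c + e)) := by fun_prop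
    exact (hc.continuousAt.eventually (lt_mem_nhds (he p hp))).filter_mono nhdsWithin_le_nhds
  have h3 : ∀ᶠ b' in 𝓝[≠] b, b' ≠ 0 := by
    by_cases hb : b = 0
    · subst hb
      exact self_mem_nhdsWithin
    · exact (eventually_ne_nhds hb).filter_mono nhdsWithin_le_nhds
  obtain ⟨b', hb', hb'0⟩ := (h2.and h3).exists
  have h4 : ∀ᶠ z in 𝓝 ((-a / b', -(c + e) / b') : ℝ × ℝ),
      ∀ p ∈ P, 0 < σ p * lineForm b' z.1 z.2 p := by
    rw [eventually_all_finset]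
    intro p hp
    have hc : Continuous fun z : ℝ × ℝ => σ p * lineForm b' z.1 z.2 p := by
      unfold lineForm
      fun_prop
    refine hc.continuousAt.eventually (lt_mem_nhds ?_)
    have : lineForm b' (-a / b') (-(c + e) / b') p = a * p.1 + b' * p.2 + (c + e) := by
      unfold lineForm
      field_simp
      ring
    show 0 < σ p * lineForm b' (-a / b') (-(c + e) / b') p
    rw [this]
    exact hb' p hp
  obtain ⟨ε, hε, h5⟩ := Metric.eventually_nhds_iff.1 h4
  refine ⟨b', -a / b', -(c + e) / b', ε, hb'0, hε, fun s t hs ht p hp => ?_⟩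
  have h6 := @h5 (s, t) (by
    rw [Prod.dist_eq]
    exact max_lt (by rwa [Real.dist_eq]) (by rwa [Real.dist_eq])) p hp
  constructor
  · intro hpS
    simpa [hσ, hpS] using h6
  · intro hpS
    simpa [hσ, hpS] using h6

/-- Lines can be perturbed into general position. -/
lemma exists_general_position {ι : Type*} [Fintype ι] (s₀ t₀ ε : ι → ℝ) (hε : ∀ i, 0 < ε i) :
    ∃ s t : ι → ℝ, (∀ i, |s i - s₀ i| < ε i ∧ |t i - t₀ i| < ε i) ∧ Function.Injective s ∧
      ∀ i j l, i ≠ j → l ≠ i → l ≠ j → ∀ x, s i * x + t i = s j * x + t j →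
        s l * x + t l ≠ s j * x + t j := by
  classical
  have pick : ∀ (c δ : ℝ), 0 < δ → ∀ F : Finset ℝ, ∃ y ∉ F, |y - c| < δ := by
    intro c δ hδ F
    obtain ⟨y, hy, hyF⟩ := (Set.Ioo_infinite (show c - δ < c + δ by linarith)).exists_notMem_finset F
    exact ⟨y, hyF, by rw [abs_lt]; constructor <;> linarith [hy.1, hy.2]⟩
  have main : ∀ J : Finset ι, ∃ s t : ι → ℝ, (∀ i ∈ J, |s i - s₀ i| < ε i ∧ |t i - t₀ i| < ε i) ∧
      Set.InjOn s J ∧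
      ∀ i ∈ J, ∀ j ∈ J, ∀ l ∈ J, i ≠ j → l ≠ i → l ≠ j → ∀ x, s i * x + t i = s j * x + t j →
        s l * x + t l ≠ s j * x + t j := by
    intro J
    induction J using Finset.induction_on with
    | empty => exact ⟨0, 0, by simp⟩
    | insert k J hk ih =>
      obtain ⟨s, t, hst, hinj, hgen⟩ := ih
      obtain ⟨u, huF, hu⟩ := pick (s₀ k) (ε k) (hε k) (J.image s)
      obtain ⟨v, hvF, hv⟩ := pick (t₀ k) (ε k) (hε k) ((J ×ˢ J).image fun e =>
        s e.1 * crossX s t e.1 e.2 + t e.1 - u * crossX s t e.1 e.2)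
      have hnew : ∀ i ∈ J, ∀ j ∈ J, i ≠ j → ∀ x, s i * x + t i = s j * x + t j →
          u * x + v ≠ s j * x + t j := by
        intro i hi j hj hij x hx hux
        apply hvF
        rw [mem_image]
        refine ⟨(i, j), mem_product.2 ⟨hi, hj⟩, ?_⟩
        have hd : s i - s j ≠ 0 := sub_ne_zero.2 fun e => hij (hinj hi hj e)
        have hxc : crossX s t i j = x := by
          rw [crossX, div_eq_iff hd]
          linarith
        simp only [hxc]
        linarith
      have hs' : ∀ i ∈ J, Function.update s k u i = s i := fun i hi =>
        Function.update_of_ne (fun e => hk (by rwa [← e])) _ _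
      have ht' : ∀ i ∈ J, Function.update t k v i = t i := fun i hi =>
        Function.update_of_ne (fun e => hk (by rwa [← e])) _ _
      refine ⟨Function.update s k u, Function.update t k v, ?_, ?_, ?_⟩
      · intro i hi
        rcases mem_insert.1 hi with rfl | hi
        · simpa using ⟨hu, hv⟩
        · rw [hs' i hi, ht' i hi]
          exact hst i hi
      · intro i hi j hj hij
        rcases mem_insert.1 hi with rfl | hi' <;> rcases mem_insert.1 hj with rfl | hj'
        · rfl
        · rw [hs' j hj', Function.update_self] at hij
          exact absurd (mem_image.2 ⟨j, hj', hij.symm⟩) huF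
        · rw [hs' i hi', Function.update_self] at hij
          exact absurd (mem_image.2 ⟨i, hi', hij⟩) huF
        · rw [hs' i hi', hs' j hj'] at hij
          exact hinj hi' hj' hij
      · intro i hi j hj l hl hij hli hlj x hx hlx
        rcases mem_insert.1 hi with rfl | hi'
        · rcases mem_insert.1 hj with rfl | hj'
          · exact hij rfl
          rcases mem_insert.1 hl with rfl | hl'
          · exact hli rfl
          rw [hs' j hj', ht' j hj', Function.update_self, Function.update_self] at hx
          rw [hs' j hj', ht' j hj', hs' l hl', ht' l hl'] at hlx
          exact hnew l hl' j hj' hlj x hlx hx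
        · rcases mem_insert.1 hj with rfl | hj'
          · rcases mem_insert.1 hl with rfl | hl'
            · exact hlj rfl
            rw [hs' i hi', ht' i hi', Function.update_self, Function.update_self] at hx
            rw [hs' l hl', ht' l hl', Function.update_self, Function.update_self] at hlx
            exact hnew i hi' l hl' hli.symm x (hx.trans hlx.symm) hlx.symm
          · rcases mem_insert.1 hl with rfl | hl'
            · rw [hs' j hj', ht' j hj', hs' i hi', ht' i hi'] at hx
              rw [hs' j hj', ht' j hj', Function.update_self, Function.update_self] at hlx
              exact hnew i hi' j hj' hij x hx hlx
            · rw [hs' j hj', ht' j hj', hs' i hi', ht' i hi'] at hx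
              rw [hs' j hj', ht' j hj', hs' l hl', ht' l hl'] at hlx
              exact hgen i hi' j hj' l hl' hij hli hlj x hx hlx
  obtain ⟨s, t, h1, h2, h3⟩ := main univ
  exact ⟨s, t, fun i => h1 i (mem_univ _), fun i j h => h2 (mem_univ _) (mem_univ _) h,
    fun i j l => h3 i (mem_univ _) j (mem_univ _) l (mem_univ _)⟩

/-- The traces in `H` that contain exactly one of the points `p` and `q`. -/
noncomputable def separating (H : Finset (Finset (ℝ × ℝ))) (p q : ℝ × ℝ) : Finset (Finset (ℝ × ℝ)) :=
  H.filter fun S => ¬(p ∈ S ↔ q ∈ S)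

lemma card_copies (H : Finset (Finset (ℝ × ℝ))) (N : Finset (ℝ × ℝ) → ℕ)
    (Q : Finset (ℝ × ℝ) → Prop) [DecidablePred Q] :
    (univ.filter fun l : (Σ S : H, Fin (N S)) => Q l.1).card = ∑ S ∈ H.filter Q, N S := by
  rw [card_filter, Fintype.sum_sigma, sum_filter, ← sum_coe_sort H]
  refine sum_congr rfl fun S _ => ?_
  by_cases h : Q S <;> simp [h]

/-- Packing lemma for points that lie in few halfplanes, with multiplicities. -/
lemma shallow_packing_multiplicity (P : Finset (ℝ × ℝ)) (H : Finset (Finset (ℝ × ℝ)))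
    (hH : ∀ S ∈ H, IsTrace P S) (N : Finset (ℝ × ℝ) → ℕ) (r K : ℕ) (V : Finset (ℝ × ℝ))
    (hVP : V ⊆ P) (hr : r + 1 ≤ ∑ S ∈ H, N S)
    (hK : ∀ p ∈ V, ∑ S ∈ H.filter (fun S => p ∈ S), N S ≤ K)
    (hsep : ∀ p ∈ V, ∀ q ∈ V, p ≠ q → 4 * r + 3 ≤ ∑ S ∈ separating H p q, N S) :
    V.card * (r * r) ≤ (∑ S ∈ H, N S) * (2 * (K + 2 * r + 2)) := by
  classical
  let ι := Σ S : H, Fin (N S)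
  have hcard : Fintype.card ι = ∑ S ∈ H, N S := by
    have := card_copies H N (fun _ => True)
    simpa [ι] using this
  have hreal := fun i : ι => (hH i.1 i.1.2).exists_open_lines
  choose b s₀ t₀ ε hb hε hreal using hreal
  obtain ⟨s, t, hst, hinj, hgen⟩ := exists_general_position s₀ t₀ ε hε
  have hpos : ∀ p ∈ V, ∀ i : ι, p ∈ i.1.1 ↔ 0 < lineForm (b i) (s i) (t i) p := by
    intro p hp i
    have := hreal i (s i) (t i) (hst i).1 (hst i).2 p (hVP hp)
    refine ⟨this.1, fun h => ?_⟩
    by_contra hn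
    exact lt_asymm h (this.2 hn)
  have hneg : ∀ p ∈ V, ∀ i : ι, p ∉ i.1.1 ↔ lineForm (b i) (s i) (t i) p < 0 := by
    intro p hp i
    have := hreal i (s i) (t i) (hst i).1 (hst i).2 p (hVP hp)
    refine ⟨this.2, fun h hn => lt_asymm h (this.1 hn)⟩
  rw [← hcard] at hr ⊢
  refine shallow_packing_simple b s t hb hinj ?_ r K hr V ?_ ?_ ?_
  · intro i j l hij hli hlj h0
    have hd : s i - s j ≠ 0 := sub_ne_zero.2 fun e => hij (hinj e)
    have h1 : s i * crossX s t i j + t i = s j * crossX s t i j + t j := by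
      rw [crossX]; field_simp; ring
    refine hgen i j l hij hli hlj _ h1 ?_
    unfold lineForm crossPt at h0
    have := (mul_eq_zero.1 h0).resolve_left (hb l)
    simp only at this
    linarith
  · intro p hp i h0
    by_cases h : p ∈ i.1.1
    · have := (hpos p hp i).1 h
      linarith
    · have := (hneg p hp i).1 h
      linarith
  · intro p hp
    refine le_trans (le_of_eq ?_) (hK p hp)
    rw [← card_copies H N]
    congr 1
    ext i
    simp only [mem_filter, mem_univ, true_and]
    exact (hpos p hp i).symm
  · intro p hp q hq hpq
    refine (hsep p hp q hq hpq).trans (le_of_eq ?_)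
    unfold separating
    rw [← card_copies H N]
    congr 1
    ext i
    simp only [mem_filter, mem_univ, true_and]
    rw [mul_neg_iff, ← hpos p hp i, ← hneg p hp i, ← hpos q hq i, ← hneg q hq i]
    tauto

/-- Packing lemma for points that lie in few halfplanes, with real weights. -/
lemma shallow_packing (P : Finset (ℝ × ℝ)) (H : Finset (Finset (ℝ × ℝ)))
    (hH : ∀ S ∈ H, IsTrace P S) (μ : Finset (ℝ × ℝ) → ℝ) (hμ : ∀ S, 0 ≤ μ S)
    (V : Finset (ℝ × ℝ)) (hVP : V ⊆ P) (hV : 2 ≤ V.card) (D δ : ℝ) (hδ : 0 < δ)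
    (hD : ∀ p ∈ V, ∑ S ∈ H.filter (fun S => p ∈ S), μ S ≤ D)
    (hsep : ∀ p ∈ V, ∀ q ∈ V, p ≠ q → δ ≤ ∑ S ∈ separating H p q, μ S) :
    (V.card : ℝ) * δ ^ 2 ≤ 130 * (∑ S ∈ H, μ S) * D := by
  obtain ⟨p₀, hp₀, q₀, hq₀, hpq₀⟩ := one_lt_card.1 hV
  have hM0 : 0 ≤ ∑ S ∈ H, μ S := sum_nonneg fun S _ => hμ S
  have hD0 : 0 ≤ D := (sum_nonneg fun S _ => hμ S).trans (hD p₀ hp₀)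
  have hδD : δ ≤ 2 * D := by
    have h1 := hsep p₀ hp₀ q₀ hq₀ hpq₀
    have h2 : ∑ S ∈ separating H p₀ q₀, μ S ≤
        ∑ S ∈ H.filter (fun S => p₀ ∈ S), μ S + ∑ S ∈ H.filter (fun S => q₀ ∈ S), μ S := by
      unfold separating
      rw [sum_filter, sum_filter, sum_filter, ← sum_add_distrib]
      refine sum_le_sum fun S _ => ?_
      have := hμ S
      by_cases h1 : p₀ ∈ S <;> by_cases h2 : q₀ ∈ S <;> simp [h1, h2, this]
    linarith [hD p₀ hp₀, hD q₀ hq₀]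
  set r : ℕ := H.card + 3 with hr
  set Λ : ℝ := (4 * r + 3 + H.card) / δ with hΛ
  have hΛ0 : 0 ≤ Λ := by positivity
  have hΛδ : Λ * δ = 4 * r + 3 + H.card := by rw [hΛ]; field_simp
  set N : Finset (ℝ × ℝ) → ℕ := fun S => ⌊Λ * μ S⌋₊ with hN
  have hup : ∀ F : Finset (Finset (ℝ × ℝ)), ((∑ S ∈ F, N S : ℕ) : ℝ) ≤ Λ * ∑ S ∈ F, μ S := by
    intro F
    push_cast
    rw [mul_sum]
    exact sum_le_sum fun S _ => Nat.floor_le (mul_nonneg hΛ0 (hμ S))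
  have hlow : ∀ F ⊆ H, Λ * ∑ S ∈ F, μ S - H.card ≤ ((∑ S ∈ F, N S : ℕ) : ℝ) := by
    intro F hF
    have h1 : (F.card : ℝ) ≤ H.card := by exact_mod_cast card_le_card hF
    have h2 : Λ * ∑ S ∈ F, μ S ≤ ∑ S ∈ F, ((N S : ℝ) + 1) := by
      rw [mul_sum]
      exact sum_le_sum fun S _ => (Nat.lt_floor_add_one _).le
    rw [sum_add_distrib, sum_const, nsmul_eq_mul, mul_one] at h2
    push_cast
    linarith
  have hsepN : ∀ p ∈ V, ∀ q ∈ V, p ≠ q → 4 * r + 3 ≤ ∑ S ∈ separating H p q, N S := by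
    intro p hp q hq hpq
    have h1 := hlow (separating H p q) (filter_subset _ _)
    have h2 := mul_le_mul_of_nonneg_left (hsep p hp q hq hpq) hΛ0
    have h3 : ((4 * r + 3 : ℕ) : ℝ) ≤ ((∑ S ∈ separating H p q, N S : ℕ) : ℝ) := by
      push_cast at h1 ⊢
      linarith
    exact_mod_cast h3
  have hNr : r + 1 ≤ ∑ S ∈ H, N S := by
    have h1 := hsepN p₀ hp₀ q₀ hq₀ hpq₀
    have h2 : ∑ S ∈ separating H p₀ q₀, N S ≤ ∑ S ∈ H, N S :=
      sum_le_sum_of_subset (filter_subset _ _)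
    omega
  have hpack := shallow_packing_multiplicity P H hH N r ⌊Λ * D⌋₊ V hVP hNr (fun p hp =>
    Nat.le_floor ((hup _).trans (mul_le_mul_of_nonneg_left (hD p hp) hΛ0))) hsepN
  have hpack' : (V.card : ℝ) * (r * r) ≤ (Λ * ∑ S ∈ H, μ S) * (2 * (Λ * D + 2 * r + 2)) := by
    have h1 : ((V.card * (r * r) : ℕ) : ℝ) ≤
        (((∑ S ∈ H, N S) * (2 * (⌊Λ * D⌋₊ + 2 * r + 2)) : ℕ) : ℝ) := by exact_mod_cast hpack
    have h2 := hup H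
    have h3 : (⌊Λ * D⌋₊ : ℝ) ≤ Λ * D := Nat.floor_le (by positivity)
    push_cast at h1 h2
    refine h1.trans ?_
    gcongr
  have hr0 : (3 : ℝ) ≤ r := by rw [hr]; push_cast; linarith [Nat.cast_nonneg (α := ℝ) H.card]
  have hΛr : Λ * δ ≤ 5 * r := by
    rw [hΛδ, hr]
    push_cast
    linarith
  have h1 : (V.card : ℝ) * δ ^ 2 * (r * r) ≤ 130 * (∑ S ∈ H, μ S) * D * (r * r) := by
    calc (V.card : ℝ) * δ ^ 2 * (r * r) = δ ^ 2 * (V.card * (r * r)) := by ring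
      _ ≤ δ ^ 2 * ((Λ * ∑ S ∈ H, μ S) * (2 * (Λ * D + 2 * r + 2))) := by gcongr
      _ = 2 * (∑ S ∈ H, μ S) * ((Λ * δ) * ((Λ * δ) * D + (2 * r + 2) * δ)) := by ring
      _ ≤ 2 * (∑ S ∈ H, μ S) * ((5 * r) * ((5 * r) * D + (4 * r) * (2 * D))) := by
        gcongr
        linarith
      _ = 130 * (∑ S ∈ H, μ S) * D * (r * r) := by ring
  exact le_of_mul_le_mul_right h1 (by positivity)

open Classical in
/-- The subsets of `P` cut out by closed halfplanes. -/
noncomputable def traces (P : Finset (ℝ × ℝ)) : Finset (Finset (ℝ × ℝ)) :=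
  P.powerset.filter (IsTrace P)

lemma mem_traces {P S : Finset (ℝ × ℝ)} : S ∈ traces P ↔ IsTrace P S := by
  classical
  rw [traces, mem_filter, mem_powerset]
  exact ⟨fun h => h.2, fun h => ⟨h.1, h⟩⟩

/-- Halfplanes shatter no set of four points. -/
lemma card_le_three_of_shatters {P s : Finset (ℝ × ℝ)} (hs : (traces P).Shatters s) :
    s.card ≤ 3 := by
  classical
  by_contra! hcard
  have hsP : s ⊆ P := by
    obtain ⟨t, ht, hst⟩ := hs.exists_superset
    exact hst.trans (mem_traces.1 ht).1
  have hdep : ¬ AffineIndependent ℝ (fun p : s => (p : ℝ × ℝ)) := by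
    intro hind
    have : Nonempty s := by
      obtain ⟨p, hp⟩ := card_pos.1 (show 0 < s.card by omega)
      exact ⟨⟨p, hp⟩⟩
    have h1 := hind.finrank_vectorSpan_add_one
    have h2 := Submodule.finrank_le (vectorSpan ℝ (Set.range fun p : s => (p : ℝ × ℝ)))
    rw [Module.finrank_prod, Module.finrank_self] at h2
    rw [Fintype.card_coe] at h1
    omega
  obtain ⟨I, x, hxI, hxJ⟩ := Convex.radon_partition hdep
  obtain ⟨u, hu, hsu⟩ := hs (filter_subset (fun p => ∃ h : p ∈ s, (⟨p, h⟩ : s) ∈ I) s)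
  obtain ⟨-, a, b, c, habc⟩ := mem_traces.1 hu
  have hiff : ∀ p : s, p ∈ I ↔ 0 ≤ a * p.1.1 + b * p.1.2 + c := by
    intro p
    rw [← habc p.1 (hsP p.2)]
    have h1 : p.1 ∈ s ∩ u ↔ p.1 ∈ s ∧ ∃ h : p.1 ∈ s, (⟨p.1, h⟩ : s) ∈ I := by
      rw [hsu, mem_filter]
    rw [mem_inter] at h1
    constructor
    · intro hp
      exact (h1.2 ⟨p.2, p.2, hp⟩).2
    · intro hp
      obtain ⟨-, h, h2⟩ := h1.1 ⟨p.2, hp⟩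
      exact h2
  have hx1 : x ∈ {p : ℝ × ℝ | 0 ≤ a * p.1 + b * p.2 + c} := by
    refine convexHull_min ?_ ?_ hxI
    · rintro _ ⟨p, hp, rfl⟩
      exact (hiff p).1 hp
    · intro p hp q hq α β hα hβ hαβ
      simp only [Set.mem_ofPred_eq, Prod.fst_add, Prod.snd_add, Prod.smul_fst, Prod.smul_snd,
        smul_eq_mul] at hp hq ⊢
      have hc : c = α * c + β * c := by rw [← add_mul, hαβ, one_mul]
      linarith [mul_nonneg hα hp, mul_nonneg hβ hq]
  have hx2 : x ∈ {p : ℝ × ℝ | a * p.1 + b * p.2 + c < 0} := by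
    refine convexHull_min ?_ ?_ hxJ
    · rintro _ ⟨p, hp, rfl⟩
      exact not_le.1 (mt (hiff p).2 hp)
    · intro p hp q hq α β hα hβ hαβ
      simp only [Set.mem_ofPred_eq, Prod.fst_add, Prod.snd_add, Prod.smul_fst, Prod.smul_snd,
        smul_eq_mul] at hp hq ⊢
      have hc : c = α * c + β * c := by rw [← add_mul, hαβ, one_mul]
      have : α * (a * p.1 + b * p.2 + c) + β * (a * q.1 + b * q.2 + c) < 0 := by
        rcases hα.eq_or_lt with h0 | h0
        · have : β = 1 := by linarith
          rw [← h0, this]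
          linarith
        · linarith [mul_neg_of_pos_of_neg h0 hp, mul_nonpos_of_nonneg_of_nonpos hβ hq.le]
      linarith
  rw [Set.mem_ofPred_eq] at hx1 hx2
  exact absurd hx1 (not_le.2 hx2)

lemma card_traces_le (P : Finset (ℝ × ℝ)) : (traces P).card ≤ (P.card + 1) ^ 3 := by
  classical
  have h1 : (traces P).shatterer ⊆ (range 4).biUnion fun k => powersetCard k P := by
    intro s hs
    rw [mem_shatterer] at hs
    obtain ⟨t, ht, hst⟩ := hs.exists_superset
    rw [mem_biUnion]
    exact ⟨s.card, mem_range.2 (Nat.lt_succ_of_le (card_le_three_of_shatters hs)),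
      mem_powersetCard.2 ⟨hst.trans (mem_traces.1 ht).1, rfl⟩⟩
  calc (traces P).card ≤ _ := card_le_card_shatterer _
    _ ≤ _ := card_le_card h1
    _ ≤ ∑ k ∈ range 4, (powersetCard k P).card := card_biUnion_le
    _ ≤ ∑ k ∈ range 4, P.card ^ k := sum_le_sum fun k _ => by
        rw [card_powersetCard]
        exact Nat.choose_le_pow _ _
    _ ≤ (P.card + 1) ^ 3 := by
        simp only [sum_range_succ, sum_range_zero]
        ring_nf
        omega

lemma traces_nonempty (P : Finset (ℝ × ℝ)) : (traces P).Nonempty :=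
  ⟨P, mem_traces.2 ⟨Subset.rfl, 0, 0, 0, fun p hp => by simpa using hp⟩⟩

lemma sum_traces_depth (H : Finset (Finset (ℝ × ℝ))) (μ : Finset (ℝ × ℝ) → ℝ)
    (R : Finset (ℝ × ℝ)) :
    ∑ p ∈ R, ∑ S ∈ H.filter (fun S => p ∈ S), μ S = ∑ S ∈ H, μ S * (R ∩ S).card := by
  simp_rw [sum_filter]
  rw [sum_comm]
  refine sum_congr rfl fun S _ => ?_
  rw [← sum_filter, sum_const, filter_mem_eq_inter, nsmul_eq_mul, mul_comm]

/-- Some pair of points of `R` is separated by few halfplanes. -/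
lemma exists_close_pair (P R : Finset (ℝ × ℝ)) (hRP : R ⊆ P) (hR : 2 ≤ R.card)
    (μ : Finset (ℝ × ℝ) → ℝ) (hμ : ∀ S, 0 ≤ μ S) (W q : ℝ) (hW : 0 < W) (hq : 0 < q)
    (hM : ∑ S ∈ traces P, μ S ≤ W) (hMq : ∑ S ∈ traces P, μ S ≤ W / q)
    (hdepth : ∑ S ∈ traces P, μ S * (R ∩ S).card ≤ W * q) :
    ∃ x ∈ R, ∃ y ∈ R, x ≠ y ∧
      ∑ S ∈ separating (traces P) x y, μ S ≤ 23 * W / R.card := by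
  have hm : (0 : ℝ) < R.card := by exact_mod_cast (show 0 < R.card by omega)
  have hle : ∀ x y, ∑ S ∈ separating (traces P) x y, μ S ≤ W := fun x y =>
    (sum_le_sum_of_subset_of_nonneg (filter_subset _ _) fun S _ _ => hμ S).trans hM
  rcases Nat.lt_or_ge R.card 4 with h4 | h4
  · obtain ⟨x, hx, y, hy, hxy⟩ := one_lt_card.1 hR
    refine ⟨x, hx, y, hy, hxy, (hle x y).trans ?_⟩
    rw [le_div_iff₀ hm]
    have : (R.card : ℝ) ≤ 23 := by exact_mod_cast (show R.card ≤ 23 by omega)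
    nlinarith
  by_contra! hcon
  set D : ℝ := 2 * W * q / R.card with hD
  have hD0 : 0 < D := by positivity
  set V := R.filter fun p => ∑ S ∈ (traces P).filter (fun S => p ∈ S), μ S ≤ D with hV
  have hdeep : ((R.filter fun p => ¬ ∑ S ∈ (traces P).filter (fun S => p ∈ S), μ S ≤ D).card : ℝ)
      * D ≤ W * q := by
    rw [← sum_traces_depth] at hdepth
    refine le_trans ?_ hdepth
    rw [← nsmul_eq_mul]
    refine (card_nsmul_le_sum _ _ D fun p hp => ?_).trans
      (sum_le_sum_of_subset_of_nonneg (filter_subset _ _) fun p _ _ => sum_nonneg fun S _ => hμ S)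
    exact (not_le.1 (mem_filter.1 hp).2).le
  have hsplit : (V.card : ℝ) +
      (R.filter fun p => ¬ ∑ S ∈ (traces P).filter (fun S => p ∈ S), μ S ≤ D).card = R.card := by
    exact_mod_cast card_filter_add_card_filter_not (s := R)
      (fun p => ∑ S ∈ (traces P).filter (fun S => p ∈ S), μ S ≤ D)
  have hVhalf : (R.card : ℝ) / 2 ≤ V.card := by
    have h1 : (R.card : ℝ) * D = 2 * (W * q) := by rw [hD]; field_simp
    have h2 : 2 * ((R.card : ℝ) - V.card) * D ≤ R.card * D := by rw [h1]; nlinarith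
    have := le_of_mul_le_mul_right h2 hD0
    linarith
  have hV2 : 2 ≤ V.card := by
    have : (4 : ℝ) ≤ R.card := by exact_mod_cast h4
    have : (2 : ℝ) ≤ V.card := by linarith
    exact_mod_cast this
  have hpack := shallow_packing P (traces P) (fun S hS => mem_traces.1 hS) μ hμ V
    ((filter_subset _ _).trans hRP) hV2 D (23 * W / R.card) (by positivity)
    (fun p hp => (mem_filter.1 hp).2)
    (fun p hp p' hp' hpp => (hcon p (mem_filter.1 hp).1 p' (mem_filter.1 hp').1 hpp).le)
  have h1 : (R.card : ℝ) / 2 * (23 * W / R.card) ^ 2 ≤ 130 * (W / q) * D := by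
    refine le_trans ?_ (hpack.trans ?_) <;> gcongr
  have h2 : (R.card : ℝ) / 2 * (23 * W / R.card) ^ 2 = 529 / 2 * (W ^ 2 / R.card) := by
    field_simp; ring
  have h3 : 130 * (W / q) * D = 260 * (W ^ 2 / R.card) := by
    rw [hD]; field_simp; ring
  have h5 : 0 < W ^ 2 / R.card := by positivity
  linarith

lemma cosh_sub_one_le {x : ℝ} (hx : |x| ≤ 1) : Real.cosh x ≤ 1 + x ^ 2 := by
  have hx2 : x ^ 2 ≤ 1 := (sq_le_one_iff_abs_le_one x).2 hx
  have h1 := Real.cosh_le_exp_half_sq x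
  have h2 := Real.abs_exp_sub_one_le (x := x ^ 2 / 2) (by
    rw [abs_of_nonneg (by positivity)]; linarith)
  rw [abs_of_nonneg (a := x ^ 2 / 2) (by positivity)] at h2
  linarith [(abs_le.1 h2).2]

lemma card_inter_eq_sum_ite (A S : Finset (ℝ × ℝ)) :
    ((A ∩ S).card : ℝ) = ∑ p ∈ A, if p ∈ S then (1 : ℝ) else 0 := by
  rw [sum_boole, filter_mem_eq_inter]

lemma growth_step {m : ℝ} (hm : 2 ≤ m) : (m - 1) ^ 23 * (1 + 23 / m) ≤ (m + 1) ^ 23 := by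
  have h1 : 0 < m - 1 := by linarith
  have h2 : 1 + (23 : ℕ) * (2 / (m - 1)) ≤ (1 + 2 / (m - 1)) ^ 23 :=
    one_add_mul_le_pow (by have : 0 ≤ 2 / (m - 1) := by positivity
                           linarith) 23
  have h3 : 23 / m ≤ (23 : ℕ) * (2 / (m - 1)) := by
    push_cast
    rw [← mul_div_assoc, div_le_div_iff₀ (by linarith) h1]
    linarith
  calc (m - 1) ^ 23 * (1 + 23 / m) ≤ (m - 1) ^ 23 * (1 + 2 / (m - 1)) ^ 23 := by
        gcongr
        linarith
    _ = (m + 1) ^ 23 := by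
        rw [← mul_pow]
        congr 1
        field_simp
        ring

/-- Points can be halved so that the potential grows by a polynomial factor only. -/
lemma exists_half_potential (P : Finset (ℝ × ℝ)) (lam : Finset (ℝ × ℝ) → ℝ) (q : ℝ) (hq : 0 < q)
    (h0 : ∀ S, 0 ≤ lam S) (h1 : ∀ S, lam S ≤ 1) (hlq : ∀ S, lam S ^ 2 * q ≤ 1)
    (hld : ∀ S, lam S ^ 2 * S.card ≤ q) (m : ℕ) :
    ∀ R ⊆ P, R.card = m → ∀ X : Finset (ℝ × ℝ) → ℝ, ∃ Z ⊆ R, Z.card = m / 2 ∧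
      ∑ S ∈ traces P, Real.cosh (lam S * (X S + (2 * (Z ∩ S).card - (R ∩ S).card))) ≤
        ((m : ℝ) + 1) ^ 23 * ∑ S ∈ traces P, Real.cosh (lam S * X S) := by
  classical
  induction m using Nat.strong_induction_on with
  | _ m ih =>
  intro R hRP hRm X
  have hW : 0 < ∑ S ∈ traces P, Real.cosh (lam S * X S) :=
    sum_pos (fun S _ => Real.cosh_pos _) (traces_nonempty P)
  rcases Nat.lt_or_ge m 2 with hm | hm
  · have hmcase : m = 0 ∨ m = 1 := by omega
    refine ⟨∅, empty_subset _, by rw [card_empty]; omega, ?_⟩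
    rcases hmcase with rfl | rfl
    · rw [card_eq_zero] at hRm
      subst hRm
      simp
    · rw [mul_sum]
      refine sum_le_sum fun S _ => ?_
      have hc0 : (0 : ℝ) ≤ (R ∩ S).card := Nat.cast_nonneg _
      have hc1 : ((R ∩ S).card : ℝ) ≤ 1 := by
        have := card_le_card (inter_subset_left (s₁ := R) (s₂ := S))
        rw [hRm] at this
        exact_mod_cast this
      set c : ℝ := ((R ∩ S).card : ℝ)
      have hlc : |-(lam S * c)| ≤ 1 := by
        rw [abs_neg, abs_of_nonneg (mul_nonneg (h0 S) hc0)]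
        nlinarith [h0 S, h1 S]
      have e : lam S * (X S + (2 * ((∅ ∩ S : Finset (ℝ × ℝ)).card : ℝ) - c)) =
          lam S * X S + -(lam S * c) := by simp; ring
      rw [e]
      have hcosh := Real.cosh_pos (lam S * X S)
      have h4 := cosh_sub_one_le hlc
      have h5 : (-(lam S * c)) ^ 2 ≤ 1 := (sq_le_one_iff_abs_le_one _).2 hlc
      have h6 : 0 ≤ Real.cosh (lam S * X S - -(lam S * c)) := (Real.cosh_pos _).le
      have h7 : Real.cosh (lam S * X S + -(lam S * c)) + Real.cosh (lam S * X S - -(lam S * c)) =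
          2 * Real.cosh (lam S * X S) * Real.cosh (-(lam S * c)) := by
        rw [Real.cosh_add, Real.cosh_sub]; ring
      have h8 : Real.cosh (lam S * X S) * Real.cosh (-(lam S * c)) ≤
          Real.cosh (lam S * X S) * 2 := by
        gcongr
        linarith
      norm_num
      linarith
  have hm' : (2 : ℝ) ≤ m := by exact_mod_cast hm
  set W := ∑ S ∈ traces P, Real.cosh (lam S * X S) with hWdef
  have hμ : ∀ S, 0 ≤ lam S ^ 2 * Real.cosh (lam S * X S) := fun S =>
    mul_nonneg (sq_nonneg _) (Real.cosh_pos _).le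
  obtain ⟨x, hx, y, hy, hxy, hclose⟩ := exists_close_pair P R hRP (by omega)
    (fun S => lam S ^ 2 * Real.cosh (lam S * X S)) hμ W q hW hq (by
      refine sum_le_sum fun S _ => mul_le_of_le_one_left (Real.cosh_pos _).le ?_
      exact pow_le_one₀ (h0 S) (h1 S)) (by
      rw [le_div_iff₀ hq, hWdef, sum_mul]
      refine sum_le_sum fun S _ => ?_
      calc _ = (lam S ^ 2 * q) * Real.cosh (lam S * X S) := by ring
        _ ≤ _ := mul_le_of_le_one_left (Real.cosh_pos _).le (hlq S)) (by
      rw [hWdef, sum_mul]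
      refine sum_le_sum fun S hS => ?_
      have h2 : ((R ∩ S).card : ℝ) ≤ S.card := by exact_mod_cast card_le_card inter_subset_right
      calc lam S ^ 2 * Real.cosh (lam S * X S) * (R ∩ S).card
          ≤ lam S ^ 2 * Real.cosh (lam S * X S) * S.card :=
            mul_le_mul_of_nonneg_left h2 (hμ S)
        _ = Real.cosh (lam S * X S) * (lam S ^ 2 * S.card) := by ring
        _ ≤ _ := mul_le_mul_of_nonneg_left (hld S) (Real.cosh_pos _).le)
  rw [hRm] at hclose
  have finish : ∀ x ∈ R, ∀ y ∈ R, x ≠ y →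
      ∑ S ∈ traces P, Real.cosh (lam S *
        (X S + ((if x ∈ S then (1 : ℝ) else 0) - if y ∈ S then (1 : ℝ) else 0))) ≤
        W * (1 + 23 / m) →
      ∃ Z ⊆ R, Z.card = m / 2 ∧
        ∑ S ∈ traces P, Real.cosh (lam S * (X S + (2 * (Z ∩ S).card - (R ∩ S).card))) ≤
          ((m : ℝ) + 1) ^ 23 * W := by
    intro x hx y hy hxy hle
    set R' := (R.erase x).erase y with hR'
    have hyx : y ∈ R.erase x := mem_erase.2 ⟨hxy.symm, hy⟩
    have hxR' : x ∉ R' := fun h => by simp [hR'] at h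
    have hyR' : y ∉ R' := fun h => by simp [hR'] at h
    have hRins : R = insert x (insert y R') := by rw [hR', insert_erase hyx, insert_erase hx]
    have hcard' : R'.card = m - 2 := by
      rw [hR', card_erase_of_mem hyx, card_erase_of_mem hx, hRm]
      omega
    have hR'R : R' ⊆ R := (erase_subset _ _).trans (erase_subset _ _)
    obtain ⟨Z, hZR, hZc, hZ⟩ := ih (m - 2) (by omega) R' (hR'R.trans hRP) hcard'
      (fun S => X S + ((if x ∈ S then (1 : ℝ) else 0) - if y ∈ S then (1 : ℝ) else 0))
    have hxZ : x ∉ Z := fun h => hxR' (hZR h)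
    refine ⟨insert x Z, insert_subset hx (hZR.trans hR'R), ?_, ?_⟩
    · rw [card_insert_of_notMem hxZ, hZc]
      omega
    · have e : ∀ S, X S + (2 * ((insert x Z ∩ S).card : ℝ) - (R ∩ S).card) =
          X S + ((if x ∈ S then (1 : ℝ) else 0) - if y ∈ S then (1 : ℝ) else 0) +
            (2 * (Z ∩ S).card - (R' ∩ S).card) := by
        intro S
        have h2 : x ∉ insert y R' := by simp [hxy, hxR']
        rw [card_inter_eq_sum_ite, card_inter_eq_sum_ite R, hRins, sum_insert hxZ, sum_insert h2,
          sum_insert hyR', card_inter_eq_sum_ite, card_inter_eq_sum_ite]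
        ring
      simp_rw [e]
      have hc : ((m - 2 : ℕ) : ℝ) + 1 = m - 1 := by
        rw [Nat.cast_sub hm]
        push_cast
        ring
      rw [hc] at hZ
      calc _ ≤ _ := hZ
        _ ≤ ((m : ℝ) - 1) ^ 23 * (W * (1 + 23 / m)) := by
            exact mul_le_mul_of_nonneg_left hle (pow_nonneg (by linarith) _)
        _ = (((m : ℝ) - 1) ^ 23 * (1 + 23 / m)) * W := by ring
        _ ≤ _ := by
            exact mul_le_mul_of_nonneg_right (growth_step hm') hW.le
  have hsum : ∑ S ∈ traces P, Real.cosh (lam S *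
        (X S + ((if x ∈ S then (1 : ℝ) else 0) - if y ∈ S then (1 : ℝ) else 0))) +
      ∑ S ∈ traces P, Real.cosh (lam S *
        (X S + ((if y ∈ S then (1 : ℝ) else 0) - if x ∈ S then (1 : ℝ) else 0))) ≤
      2 * (W * (1 + 23 / m)) := by
    have h2 : W * (1 + 23 / m) = W + 23 * W / m := by ring
    rw [h2]
    have h3 : ∑ S ∈ traces P, Real.cosh (lam S *
          (X S + ((if x ∈ S then (1 : ℝ) else 0) - if y ∈ S then (1 : ℝ) else 0))) +
        ∑ S ∈ traces P, Real.cosh (lam S *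
          (X S + ((if y ∈ S then (1 : ℝ) else 0) - if x ∈ S then (1 : ℝ) else 0))) ≤
        2 * W + 2 * ∑ S ∈ separating (traces P) x y, lam S ^ 2 * Real.cosh (lam S * X S) := by
      rw [← sum_add_distrib, hWdef, mul_sum, mul_sum, separating, sum_filter, ← sum_add_distrib]
      refine sum_le_sum fun S _ => ?_
      have hcosh := Real.cosh_pos (lam S * X S)
      have h4 : Real.cosh (lam S) ≤ 1 + lam S ^ 2 :=
        cosh_sub_one_le (by rw [abs_of_nonneg (h0 S)]; exact h1 S)
      have h7 : Real.cosh (lam S * X S + lam S) + Real.cosh (lam S * X S - lam S) ≤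
          2 * Real.cosh (lam S * X S) + 2 * (lam S ^ 2 * Real.cosh (lam S * X S)) := by
        calc _ = 2 * Real.cosh (lam S * X S) * Real.cosh (lam S) := by
              rw [Real.cosh_add, Real.cosh_sub]; ring
          _ ≤ 2 * Real.cosh (lam S * X S) * (1 + lam S ^ 2) := by gcongr
          _ = _ := by ring
      by_cases hxS : x ∈ S <;> by_cases hyS : y ∈ S <;>
        simp only [hxS, hyS, if_true, if_false, not_true_eq_false, not_false_eq_true, iff_true,
          iff_false, iff_self]
      · simp only [sub_self, add_zero]
        linarith
      · have e1 : lam S * (X S + (1 - 0)) = lam S * X S + lam S := by ring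
        have e2 : lam S * (X S + (0 - 1)) = lam S * X S - lam S := by ring
        rw [e1, e2]
        linarith
      · have e1 : lam S * (X S + (1 - 0)) = lam S * X S + lam S := by ring
        have e2 : lam S * (X S + (0 - 1)) = lam S * X S - lam S := by ring
        rw [e1, e2]
        linarith
      · simp only [sub_self, add_zero]
        linarith
    linarith
  rcases le_total (∑ S ∈ traces P, Real.cosh (lam S *
        (X S + ((if x ∈ S then (1 : ℝ) else 0) - if y ∈ S then (1 : ℝ) else 0))))
      (∑ S ∈ traces P, Real.cosh (lam S *
        (X S + ((if y ∈ S then (1 : ℝ) else 0) - if x ∈ S then (1 : ℝ) else 0)))) with h | h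
  · exact finish x hx y hy hxy (by linarith)
  · exact finish y hy x hx hxy.symm (by linarith)

/-- Halving with size-sensitive discrepancy `κ⁻³ (κ⁴ + |S|) log |P|`. -/
lemma exists_half (P : Finset (ℝ × ℝ)) (hP : 2 ≤ P.card) (κ : ℝ) (hκ : 1 ≤ κ) :
    ∃ Z ⊆ P, Z.card = P.card / 2 ∧ ∀ S, IsTrace P S →
      |2 * ((Z ∩ S).card : ℝ) - S.card| ≤ 54 * Real.log P.card * ((κ ^ 4 + S.card) / κ ^ 3) := by
  have hκ0 : 0 < κ := by linarith
  have hpos : ∀ S : Finset (ℝ × ℝ), 0 < κ ^ 4 + S.card := fun S => by positivity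
  obtain ⟨Z, hZP, hZc, hZ⟩ := exists_half_potential P (fun S => κ ^ 3 / (κ ^ 4 + S.card)) (κ ^ 2)
    (by positivity) (fun S => by positivity) (fun S => by
      rw [div_le_one (hpos S)]
      have h1 : κ ^ 3 ≤ κ ^ 4 := pow_le_pow_right₀ hκ (by norm_num)
      have h2 : (0 : ℝ) ≤ S.card := Nat.cast_nonneg _
      linarith) (fun S => by
      rw [div_pow, div_mul_eq_mul_div, div_le_one (by positivity)]
      have h2 : (0 : ℝ) ≤ S.card := Nat.cast_nonneg _
      calc (κ ^ 3) ^ 2 * κ ^ 2 = (κ ^ 4) ^ 2 := by ring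
        _ ≤ (κ ^ 4 + S.card) ^ 2 := by gcongr; linarith) (fun S => by
      rw [div_pow, div_mul_eq_mul_div, div_le_iff₀ (by positivity)]
      have h2 : (0 : ℝ) ≤ S.card := Nat.cast_nonneg _
      have h3 : κ ^ 4 * S.card ≤ (κ ^ 4 + S.card) ^ 2 := by
        have : 0 ≤ κ ^ 4 := by positivity
        nlinarith
      calc (κ ^ 3) ^ 2 * S.card = κ ^ 2 * (κ ^ 4 * S.card) := by ring
        _ ≤ κ ^ 2 * (κ ^ 4 + S.card) ^ 2 := by gcongr) P.card P Subset.rfl rfl 0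
  refine ⟨Z, hZP, hZc, fun S hS => ?_⟩
  have hn : (2 : ℝ) ≤ P.card := by exact_mod_cast hP
  have hPS : P ∩ S = S := inter_eq_right.2 hS.1
  set lam : ℝ := κ ^ 3 / (κ ^ 4 + S.card) with hlam
  have hlam0 : 0 < lam := by rw [hlam]; have := hpos S; positivity
  set d : ℝ := 2 * ((Z ∩ S).card : ℝ) - S.card with hd
  have h1 : Real.cosh (lam * d) ≤ ((P.card : ℝ) + 1) ^ 26 := by
    have h2 := single_le_sum (f := fun S : Finset (ℝ × ℝ) => Real.cosh (κ ^ 3 / (κ ^ 4 + S.card) *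
      ((0 : Finset (ℝ × ℝ) → ℝ) S + (2 * (Z ∩ S).card - (P ∩ S).card))))
      (fun S _ => (Real.cosh_pos _).le) (mem_traces.2 hS)
    have h3 := h2.trans hZ
    simp only [Pi.zero_apply, zero_add, mul_zero, Real.cosh_zero, sum_const, nsmul_eq_mul, mul_one,
      hPS] at h3
    have h4 : ((traces P).card : ℝ) ≤ ((P.card : ℝ) + 1) ^ 3 := by exact_mod_cast card_traces_le P
    refine h3.trans ?_
    calc ((P.card : ℝ) + 1) ^ 23 * (traces P).card
        ≤ ((P.card : ℝ) + 1) ^ 23 * ((P.card : ℝ) + 1) ^ 3 := by gcongr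
      _ = _ := by ring
  have h2 : Real.exp |lam * d| ≤ (P.card : ℝ) ^ 53 := by
    have h3 : Real.exp |lam * d| ≤ 2 * Real.cosh (lam * d) := by
      rw [← Real.cosh_abs, Real.cosh_eq]
      linarith [Real.exp_pos (-|lam * d|)]
    have h5 : (P.card : ℝ) + 1 ≤ (P.card : ℝ) ^ 2 := by nlinarith
    calc Real.exp |lam * d| ≤ 2 * ((P.card : ℝ) + 1) ^ 26 := by linarith
      _ ≤ P.card * ((P.card : ℝ) ^ 2) ^ 26 := by gcongr
      _ = (P.card : ℝ) ^ 53 := by ring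
  have h3 : |lam * d| ≤ 53 * Real.log P.card := by
    have := (Real.le_log_iff_exp_le (by positivity)).2 h2
    rw [Real.log_pow] at this
    exact_mod_cast this
  have hlog : 0 ≤ Real.log P.card := Real.log_nonneg (by linarith)
  rw [abs_mul, abs_of_pos hlam0] at h3
  have h4 : (κ ^ 4 + S.card) / κ ^ 3 = 1 / lam := by rw [hlam, one_div_div]
  rw [h4, mul_one_div, le_div_iff₀ hlam0]
  linarith

lemma exists_half_relative (P : Finset (ℝ × ℝ)) (hP : 2 ≤ P.card) {κ ν : ℝ} (hκ : 1 ≤ κ)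
    (hκν : κ ^ 4 = ν * P.card) :
    ∃ Z ⊆ P, Z.card = P.card / 2 ∧ ∀ S, IsTrace P S →
      |((Z ∩ S).card : ℝ) / Z.card - S.card / P.card| ≤
        56 * Real.log P.card / κ ^ 3 * (ν + S.card / P.card) := by
  obtain ⟨Z, hZP, hZc, hZ⟩ := exists_half P hP κ hκ
  refine ⟨Z, hZP, hZc, fun S hS => ?_⟩
  have hn : (2 : ℝ) ≤ P.card := by exact_mod_cast hP
  have hm : (0 : ℝ) < Z.card := by
    have : 0 < Z.card := by omega
    exact_mod_cast this
  have hκ0 : 0 < κ := by linarith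
  obtain ⟨e, he0, he1, he⟩ : ∃ e : ℝ, 0 ≤ e ∧ e ≤ 1 ∧ (P.card : ℝ) = 2 * Z.card + e := by
    refine ⟨((P.card % 2 : ℕ) : ℝ), Nat.cast_nonneg _, ?_, ?_⟩
    · have : P.card % 2 ≤ 1 := by omega
      exact_mod_cast this
    · have : P.card = 2 * Z.card + P.card % 2 := by omega
      exact_mod_cast this
  have hz : ((Z ∩ S).card : ℝ) ≤ Z.card := by exact_mod_cast card_le_card inter_subset_left
  have hz0 : (0 : ℝ) ≤ (Z ∩ S).card := Nat.cast_nonneg _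
  have hk0 : (0 : ℝ) ≤ S.card := Nat.cast_nonneg _
  have hd := hZ S hS
  have hlog : 1 / 2 ≤ Real.log P.card := by
    have := Real.log_le_log (by norm_num) hn
    linarith [Real.log_two_gt_d9]
  have hone : 1 ≤ (κ ^ 4 + S.card) / κ ^ 3 := by
    rw [one_le_div (by positivity)]
    have h1 : κ ^ 3 ≤ κ ^ 4 := pow_le_pow_right₀ hκ (by norm_num)
    linarith
  have hrhs : 56 * Real.log P.card / κ ^ 3 * (ν + S.card / P.card) =
      56 * Real.log P.card * ((κ ^ 4 + S.card) / κ ^ 3) / P.card := by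
    rw [hκν]
    field_simp
  set z : ℝ := ((Z ∩ S).card : ℝ)
  set k : ℝ := (S.card : ℝ)
  set m : ℝ := (Z.card : ℝ)
  set n : ℝ := (P.card : ℝ)
  have hn0 : 0 < n := by linarith
  have hdiff : z / m - k / n = ((2 * z - k) + e * z / m) / n := by
    field_simp
    rw [he]
    ring
  have hez : e * z / m ≤ 1 := by
    rw [div_le_one hm]
    nlinarith
  have hez0 : 0 ≤ e * z / m := by positivity
  rw [hdiff, hrhs, abs_div, abs_of_pos hn0]
  gcongr
  calc |2 * z - k + e * z / m| ≤ |2 * z - k| + |e * z / m| := abs_add_le _ _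
    _ ≤ 54 * Real.log n * ((κ ^ 4 + k) / κ ^ 3) + 1 := by
        rw [abs_of_nonneg hez0]
        exact add_le_add hd hez
    _ ≤ _ := by nlinarith

lemma log_size_le {α ν L K τ : ℝ} (hα0 : 0 < α) (hα1 : α < 1) (hν0 : 0 < ν) (hν1 : ν < 1)
    (hL : L = Real.log (2 / (α * ν))) (hK0 : 0 < K) (hK : K ^ 3 = 10 ^ 6 * (L / α)) (hτ : 1 ≤ τ) :
    56 * Real.log (K ^ 4 * τ ^ 4 / ν) / (K * τ) ^ 3 ≤ α / 20 * (1 / τ ^ 2) := by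
  have hτ0 : 0 < τ := by linarith
  have hlα : Real.log α ≤ 0 := Real.log_nonpos hα0.le hα1.le
  have hlν : Real.log ν ≤ 0 := Real.log_nonpos hν0.le hν1.le
  have hl2 := Real.log_two_gt_d9
  have hL' : L = Real.log 2 - Real.log α - Real.log ν := by
    rw [hL, Real.log_div (by norm_num) (by positivity), Real.log_mul hα0.ne' hν0.ne']
    ring
  have hL0 : 0 < L := by linarith
  have hlK : 3 * Real.log K = 6 * Real.log 10 + Real.log L - Real.log α := by
    have h := congrArg Real.log hK
    rw [Real.log_pow, Real.log_mul (by norm_num) (by positivity), Real.log_pow,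
      Real.log_div hL0.ne' hα0.ne'] at h
    push_cast at h
    linarith
  have hlL : Real.log L ≤ L - 1 := Real.log_le_sub_one_of_pos hL0
  have hlτ : Real.log τ ≤ τ - 1 := Real.log_le_sub_one_of_pos hτ0
  have h10 : 8 * Real.log 10 ≤ 27 * Real.log 2 := by
    have h := Real.log_le_log (x := 10 ^ 8) (y := 2 ^ 27) (by norm_num) (by norm_num)
    rw [Real.log_pow, Real.log_pow] at h
    exact_mod_cast h
  have hlog : Real.log (K ^ 4 * τ ^ 4 / ν) = 4 * Real.log K + 4 * Real.log τ - Real.log ν := by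
    rw [Real.log_div (by positivity) hν0.ne', Real.log_mul (by positivity) (by positivity),
      Real.log_pow, Real.log_pow]
    push_cast
    ring
  have hbound : Real.log (K ^ 4 * τ ^ 4 / ν) ≤ 37 * (L * τ) := by
    have h1 : L ≤ L * τ := le_mul_of_one_le_right hL0.le hτ
    have h2 : 4 * τ ≤ 6 * (L * τ) := by nlinarith
    rw [hlog]
    linarith
  have hLτ : 0 ≤ L * τ := by positivity
  rw [mul_pow, hK, div_le_iff₀ (by positivity)]
  have e : α / 20 * (1 / τ ^ 2) * (10 ^ 6 * (L / α) * τ ^ 3) = 50000 * (L * τ) := by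
    field_simp
    norm_num
  rw [e]
  linarith

lemma exists_half_sample {α ν L K : ℝ} (hα0 : 0 < α) (hα1 : α < 1) (hν0 : 0 < ν) (hν1 : ν < 1)
    (hL : L = Real.log (2 / (α * ν))) (hK1 : 1 ≤ K) (hK : K ^ 3 = 10 ^ 6 * (L / α))
    (P : Finset (ℝ × ℝ)) (hP : 2 ≤ P.card) (hPB : K ^ 4 / ν < P.card) :
    ∃ Z ⊆ P, Z.card = P.card / 2 ∧ ∀ S, IsTrace P S →
      |((Z ∩ S).card : ℝ) / Z.card - S.card / P.card| ≤
        α / 20 * √(K ^ 4 / ν / P.card) * (ν + S.card / P.card) := by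
  have hK0 : 0 < K := by linarith
  have hn : (0 : ℝ) < P.card := by
    have : 0 < P.card := by omega
    exact_mod_cast this
  have hB : 0 < K ^ 4 / ν := by positivity
  set τ : ℝ := √√(P.card / (K ^ 4 / ν)) with hτdef
  have hτ2 : τ ^ 2 = √(P.card / (K ^ 4 / ν)) := Real.sq_sqrt (Real.sqrt_nonneg _)
  have hτ4 : τ ^ 4 = P.card / (K ^ 4 / ν) := by
    rw [show τ ^ 4 = (τ ^ 2) ^ 2 by ring, hτ2, Real.sq_sqrt (by positivity)]
  have hτ : 1 ≤ τ := by
    rw [hτdef, Real.one_le_sqrt, Real.one_le_sqrt, one_le_div hB]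
    exact hPB.le
  have hn' : (P.card : ℝ) = K ^ 4 * τ ^ 4 / ν := by
    rw [hτ4]
    field_simp
  obtain ⟨Z, hZP, hZc, hZ⟩ := exists_half_relative P hP (κ := K * τ) (ν := ν)
    (one_le_mul_of_one_le_of_one_le hK1 hτ) (by rw [hn']; field_simp)
  refine ⟨Z, hZP, hZc, fun S hS => (hZ S hS).trans ?_⟩
  have hs : √(K ^ 4 / ν / P.card) = 1 / τ ^ 2 := by
    rw [hτ2, ← inv_div, Real.sqrt_inv, one_div]
  rw [hs]
  refine mul_le_mul_of_nonneg_right ?_ 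
    (add_nonneg hν0.le (div_nonneg (Nat.cast_nonneg _) (Nat.cast_nonneg _)))
  have := log_size_le hα0 hα1 hν0 hν1 hL hK0 hK hτ
  rwa [← hn'] at this

lemma meas2_halfplane (a b c : ℝ) (Z : Finset (ℝ × ℝ)) :
    meas2 {x : ℝ × ℝ | 0 ≤ a * x.1 + b * x.2 + c} Z =
      ((Z.filter fun x => 0 ≤ a * x.1 + b * x.2 + c).card : ℝ) / Z.card := by
  rw [meas2, ← Set.ncard_coe_finset (Z.filter _), coe_filter]
  rfl

lemma isTrace_filter (a b c : ℝ) (P : Finset (ℝ × ℝ)) :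
    IsTrace P (P.filter fun x => 0 ≤ a * x.1 + b * x.2 + c) :=
  ⟨filter_subset _ _, a, b, c, fun p hp => by simp [hp]⟩

/-- If every large set can be halved with small relative error, then iterating the halving
gives a small sample. -/
lemma exists_sample_of_halving {α ν B : ℝ} (hα0 : 0 < α) (hα1 : α < 1) (hν0 : 0 < ν) (hB : 2 ≤ B)
    (hhalf : ∀ P : Finset (ℝ × ℝ), B < P.card → ∃ Z ⊆ P, Z.card = P.card / 2 ∧ ∀ S, IsTrace P S →
      |((Z ∩ S).card : ℝ) / Z.card - S.card / P.card| ≤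
        α / 20 * √(B / P.card) * (ν + S.card / P.card)) (n : ℕ) :
    ∀ P : Finset (ℝ × ℝ), P.Nonempty → P.card = n → ∃ Z ⊆ P, Z.Nonempty ∧ (Z.card : ℝ) ≤ B ∧
      ∀ a b c : ℝ,
        |meas2 {x : ℝ × ℝ | 0 ≤ a * x.1 + b * x.2 + c} Z -
          meas2 {x : ℝ × ℝ | 0 ≤ a * x.1 + b * x.2 + c} P| ≤
        (if (n : ℝ) ≤ B then 0 else α / 2 * (1 - √(B / n) / 2)) *
          (ν + meas2 {x : ℝ × ℝ | 0 ≤ a * x.1 + b * x.2 + c} P) := by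
  induction n using Nat.strong_induction_on with
  | _ n ih =>
  intro P hPne hPn
  by_cases hnB : (n : ℝ) ≤ B
  · exact ⟨P, Subset.rfl, hPne, by rw [hPn]; exact hnB, fun a b c => by simp [hnB]⟩
  rw [if_neg hnB]
  push Not at hnB
  have hn2 : 2 ≤ n := by
    have : (2 : ℝ) ≤ n := by linarith
    exact_mod_cast this
  obtain ⟨Y, hYP, hYc, hY⟩ := hhalf P (by rw [hPn]; exact hnB)
  rw [hPn] at hYc hY
  have hYne : Y.Nonempty := card_pos.1 (by omega)
  obtain ⟨Z, hZY, hZne, hZB, hZ⟩ := ih (n / 2) (by omega) Y hYne hYc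
  refine ⟨Z, hZY.trans hYP, hZne, hZB, fun a b c => ?_⟩
  have h1 := hZ a b c
  have h2 : |meas2 {x : ℝ × ℝ | 0 ≤ a * x.1 + b * x.2 + c} Y -
      meas2 {x : ℝ × ℝ | 0 ≤ a * x.1 + b * x.2 + c} P| ≤
      α / 20 * √(B / n) * (ν + meas2 {x : ℝ × ℝ | 0 ≤ a * x.1 + b * x.2 + c} P) := by
    have h := hY _ (isTrace_filter a b c P)
    rw [meas2_halfplane, meas2_halfplane, hPn]
    convert h using 4
    rw [inter_filter, inter_eq_left.2 hYP]
  have hx0 : 0 ≤ meas2 {x : ℝ × ℝ | 0 ≤ a * x.1 + b * x.2 + c} P := by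
    rw [meas2]
    positivity
  set xP := meas2 {x : ℝ × ℝ | 0 ≤ a * x.1 + b * x.2 + c} P
  set xY := meas2 {x : ℝ × ℝ | 0 ≤ a * x.1 + b * x.2 + c} Y
  set xZ := meas2 {x : ℝ × ℝ | 0 ≤ a * x.1 + b * x.2 + c} Z
  have hn0 : (0 : ℝ) < n := by linarith
  set s : ℝ := √(B / n) with hs
  have hs0 : 0 ≤ s := Real.sqrt_nonneg _
  have hs1 : s ≤ 1 := by
    rw [hs, Real.sqrt_le_one, div_le_one hn0]
    exact hnB.le
  set G : ℝ := if ((n / 2 : ℕ) : ℝ) ≤ B then 0 else α / 2 * (1 - √(B / (n / 2 : ℕ)) / 2) with hG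
  have hαs : α * s ≤ α := mul_le_of_le_one_right hα0.le hs1
  have hGbd : 0 ≤ G ∧ G ≤ 1 ∧ G + α / 10 * s ≤ α / 2 * (1 - s / 2) := by
    by_cases hc : ((n / 2 : ℕ) : ℝ) ≤ B
    · rw [hG, if_pos hc]
      refine ⟨le_rfl, by norm_num, by linarith⟩
    · rw [hG, if_neg hc]
      push Not at hc
      have hpos : (0 : ℝ) < (n / 2 : ℕ) := by linarith
      set s' : ℝ := √(B / (n / 2 : ℕ)) with hs'
      have hs'0 : 0 ≤ s' := Real.sqrt_nonneg _
      have hs'1 : s' ≤ 1 := by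
        rw [hs', Real.sqrt_le_one, div_le_one hpos]
        exact hc.le
      have hss : 7 / 5 * s ≤ s' := by
        rw [hs']
        refine Real.le_sqrt_of_sq_le ?_
        rw [mul_pow, hs, Real.sq_sqrt (by positivity)]
        have h3 : ((n / 2 : ℕ) : ℝ) ≤ n / 2 := Nat.cast_div_le
        calc (7 / 5) ^ 2 * (B / n) ≤ 2 * (B / n) := by
              gcongr
              norm_num
          _ = B / (n / 2) := by field_simp
          _ ≤ B / (n / 2 : ℕ) := by gcongr
      have hαs' : α * (7 / 5 * s) ≤ α * s' := by gcongr
      have hαs'1 : α * s' ≤ α := mul_le_of_le_one_right hα0.le hs'1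
      have hαs'0 : 0 ≤ α * s' := by positivity
      refine ⟨by linarith, by linarith, by linarith⟩
  obtain ⟨hG0, hG1, hG2⟩ := hGbd
  have hv : 0 ≤ ν + xP := by linarith
  set η : ℝ := α / 20 * s with hη
  have hη0 : 0 ≤ η := by positivity
  have hy : ν + xY ≤ (1 + η) * (ν + xP) := by linarith [(abs_le.1 h2).2]
  calc |xZ - xP| ≤ |xZ - xY| + |xY - xP| := abs_sub_le _ _ _
    _ ≤ G * (ν + xY) + η * (ν + xP) := add_le_add h1 h2
    _ ≤ G * ((1 + η) * (ν + xP)) + η * (ν + xP) := by gcongr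
    _ = (G + (G * η + η)) * (ν + xP) := by ring
    _ ≤ (G + α / 10 * s) * (ν + xP) := by
        gcongr
        nlinarith
    _ ≤ _ := by gcongr

end HalfplaneSamples

/-- Every finite planar point set admits a `(ν,α)`-sample of size
`O((1/(α^{4/3}ν))·log^{4/3}(2/(αν)))` with respect to closed halfplane
ranges. -/
theorem small_sample_halfplanes :
    ∃ C : ℝ, 0 < C ∧
      ∀ P : Finset (ℝ × ℝ), P.Nonempty →
        ∀ α ν : ℝ, 0 < α → α < 1 → 0 < ν → ν < 1 →
          ∃ Z : Finset (ℝ × ℝ), Z ⊆ P ∧ Z.Nonempty ∧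
            (Z.card : ℝ) ≤
              C * (1 / (α ^ ((4 : ℝ) / 3) * ν)) *
                Real.log (2 / (α * ν)) ^ ((4 : ℝ) / 3) ∧
            ∀ a b c : ℝ, (a, b) ≠ (0, 0) →
              dnu ν (meas2 {x : ℝ × ℝ | 0 ≤ a * x.1 + b * x.2 + c} Z)
                    (meas2 {x : ℝ × ℝ | 0 ≤ a * x.1 + b * x.2 + c} P) < α := by
  refine ⟨10 ^ 8, by norm_num, fun P hP α ν hα0 hα1 hν0 hν1 => ?_⟩
  obtain ⟨L, hL⟩ : ∃ L, L = Real.log (2 / (α * ν)) := ⟨_, rfl⟩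
  have hL2 : Real.log 2 ≤ L := by
    rw [hL]
    refine Real.log_le_log (by norm_num) ?_
    rw [le_div_iff₀ (by positivity)]
    nlinarith
  have hl2 := Real.log_two_gt_d9
  have hL0 : 0 < L := by linarith
  have hq0 : 0 < L / α := by positivity
  have hq : 1 / 2 ≤ L / α := by
    rw [le_div_iff₀ hα0]
    linarith
  obtain ⟨K, hK⟩ : ∃ K, K = 100 * (L / α) ^ ((1 : ℝ) / 3) := ⟨_, rfl⟩
  have hK0 : 0 < K := by rw [hK]; positivity
  have hK3 : K ^ 3 = 10 ^ 6 * (L / α) := by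
    rw [hK, mul_pow, ← Real.rpow_natCast, ← Real.rpow_natCast ((L / α) ^ _), ← Real.rpow_mul hq0.le]
    norm_num
  have hK4 : K ^ 4 = 10 ^ 8 * (L / α) ^ ((4 : ℝ) / 3) := by
    rw [hK, mul_pow, ← Real.rpow_natCast ((L / α) ^ _), ← Real.rpow_mul hq0.le]
    norm_num
  have hK2 : 2 ≤ K := by
    by_contra! h
    have : K ^ 3 < 2 ^ 3 := by gcongr
    linarith
  have hB : 2 ≤ K ^ 4 / ν := by
    rw [le_div_iff₀ hν0]
    have : (2 : ℝ) ^ 4 ≤ K ^ 4 := by gcongr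
    linarith
  obtain ⟨Z, hZP, hZne, hZB, hZ⟩ := exists_sample_of_halving hα0 hα1 hν0 hB (fun Q hQ =>
    exists_half_sample hα0 hα1 hν0 hν1 hL (by linarith) hK3 Q (by
      have : (2 : ℝ) ≤ Q.card := by linarith
      exact_mod_cast this) hQ) P.card P hP rfl
  refine ⟨Z, hZP, hZne, ?_, fun a b c _ => ?_⟩
  · refine hZB.trans_eq ?_
    rw [hK4, ← hL, Real.div_rpow hL0.le hα0.le]
    field_simp
  · have h := hZ a b c
    have hP0 : 0 ≤ meas2 {x : ℝ × ℝ | 0 ≤ a * x.1 + b * x.2 + c} P := by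
      rw [meas2]
      positivity
    have hZ0 : 0 ≤ meas2 {x : ℝ × ℝ | 0 ≤ a * x.1 + b * x.2 + c} Z := by
      rw [meas2]
      positivity
    set x := meas2 {x : ℝ × ℝ | 0 ≤ a * x.1 + b * x.2 + c} Z
    set y := meas2 {x : ℝ × ℝ | 0 ≤ a * x.1 + b * x.2 + c} P
    have hG : (if (P.card : ℝ) ≤ K ^ 4 / ν then 0 else
        α / 2 * (1 - √(K ^ 4 / ν / P.card) / 2)) ≤ α / 2 := by
      split_ifs
      · linarith
      · have := Real.sqrt_nonneg (K ^ 4 / ν / P.card)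
        nlinarith
    rw [dnu, div_lt_iff₀ (by linarith)]
    calc |x - y| ≤ _ := h
      _ ≤ α / 2 * (ν + y) := by gcongr
      _ < α * (x + y + ν) := by nlinarith
end
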